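/- arXiv:1001.0875 — 2 statements merged into one kernel-verified Lean document; each statement's English description precedes it below -/
import Mathlib

section
/- Let μ be a compactly-supported, even, isotropic, log-concave probability measure on ℝⁿ, and let K be the interior of the support of μ (a convex body in ℝⁿ). Then Vol_n(K)^{1/n} ≥ c / σ̲_n, where c > 0 is a universal constant and Vol_n is the Lebesgue measure on ℝⁿ. -/
open MeasureTheory Real Set Filter Topology RealInnerProductSpace Matrix
noncomputable section

abbrev EucSp (n : ℕ) := EuclideanSpace ℝ (Fin n)

/-- A nonnegative function is log-concave. -/
def IsLogConcaveFn {n : ℕ} (f : EucSp n → ℝ) : Prop :=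
  (∀ x, 0 ≤ f x) ∧ ∀ x y : EucSp n, ∀ l : ℝ, l ∈ Set.Icc (0:ℝ) 1 →
    f x ^ (1 - l) * f y ^ l ≤ f ((1 - l) • x + l • y)

/-- A measure is log-concave if it has a log-concave density w.r.t. Lebesgue measure. -/
def IsLogConcave {n : ℕ} (μ : Measure (EucSp n)) : Prop :=
  ∃ f : EucSp n → ℝ, IsLogConcaveFn f ∧
    μ = volume.withDensity (fun x => ENNReal.ofReal (f x))

/-- Barycenter at the origin and covariance matrix equal to the identity. -/
def IsIsotropic {n : ℕ} (μ : Measure (EucSp n)) : Prop :=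
  (∫ x, x ∂μ = 0) ∧ ∀ u v : EucSp n, (∫ x, ⟪x, u⟫ * ⟪x, v⟫ ∂μ) = ⟪u, v⟫

/-- σ_n² = sup over isotropic log-concave random vectors of E (|X| - √n)². -/
def sigmaNSq (n : ℕ) : ℝ :=
  sSup {v | ∃ μ : Measure (EucSp n), IsProbabilityMeasure μ ∧ IsIsotropic μ ∧
    IsLogConcave μ ∧ v = ∫ x, (‖x‖ - Real.sqrt n) ^ 2 ∂μ}

def sigmaN (n : ℕ) : ℝ := Real.sqrt (sigmaNSq n)

/-- σ̲_n = (1/√n) sup over isotropic log-concave random vectors of |E X |X|²|. -/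
def sigmaBar (n : ℕ) : ℝ :=
  (Real.sqrt n)⁻¹ * sSup {v | ∃ μ : Measure (EucSp n), IsProbabilityMeasure μ ∧
    IsIsotropic μ ∧ IsLogConcave μ ∧ v = ‖∫ x, (‖x‖ ^ 2) • x ∂μ‖}

/-- L_n = sup over isotropic log-concave probability densities f on ℝⁿ of f(0)^{1/n}. -/
def LN (n : ℕ) : ℝ :=
  sSup {l | ∃ (μ : Measure (EucSp n)) (f : EucSp n → ℝ),
    IsProbabilityMeasure μ ∧ IsIsotropic μ ∧ IsLogConcaveFn f ∧
    μ = volume.withDensity (fun x => ENNReal.ofReal (f x)) ∧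
    l = f 0 ^ ((n : ℝ)⁻¹)}

/-- The support of a Borel measure: the minimal closed set of full measure,
i.e. the set of points all of whose neighborhoods have positive measure. -/
def msupport {n : ℕ} (μ : Measure (EucSp n)) : Set (EucSp n) :=
  {x | ∀ U ∈ nhds x, μ U ≠ 0}

/-- μ is compactly supported. -/
def IsCompactlySupported {n : ℕ} (μ : Measure (EucSp n)) : Prop :=
  ∃ K : Set (EucSp n), IsCompact K ∧ μ Kᶜ = 0

/-- The support of μ is not contained in a hyperplane (an affine hyperplane). -/
def SuppNotInHyperplane {n : ℕ} (μ : Measure (EucSp n)) : Prop :=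
  ¬ ∃ (θ : EucSp n) (c : ℝ), θ ≠ 0 ∧ msupport μ ⊆ {x | ⟪θ, x⟫ = c}

/-- The logarithmic Laplace transform Λ_μ(ξ) = log ∫ exp(ξ·x) dμ(x). -/
def logLaplace {n : ℕ} (μ : Measure (EucSp n)) (ξ : EucSp n) : ℝ :=
  Real.log (∫ x, Real.exp ⟪ξ, x⟫ ∂μ)

/-- The Hessian matrix of a function f : ℝⁿ → ℝ at a point ξ. -/
def hessianM {n : ℕ} (f : EucSp n → ℝ) (ξ : EucSp n) : Matrix (Fin n) (Fin n) ℝ :=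
  Matrix.of fun i j =>
    fderiv ℝ (fun η => fderiv ℝ f η (EuclideanSpace.single j 1)) ξ
      (EuclideanSpace.single i 1)

/-- Ψ_μ(ξ) = log ( det ∇²Λ_μ(ξ) / det ∇²Λ_μ(0) ). -/
def PsiFn {n : ℕ} (μ : Measure (EucSp n)) (ξ : EucSp n) : ℝ :=
  Real.log ((hessianM (logLaplace μ) ξ).det / (hessianM (logLaplace μ) 0).det)

/-- A measure is even (centrally-symmetric) if μ(A) = μ(−A) for all measurable A. -/
def IsEvenMeasure {n : ℕ} (μ : Measure (EucSp n)) : Prop :=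
  ∀ A : Set (EucSp n), MeasurableSet A → μ A = μ (-A)


theorem volume_add_volume_le_of_isCompact {A B S : Set ℝ} (hA : IsCompact A) (hB : IsCompact B)
    (hA0 : A.Nonempty) (hB0 : B.Nonempty) (hS : ∀ a ∈ A, ∀ b ∈ B, a + b ∈ S) :
    volume A + volume B ≤ volume S := by
  obtain ⟨a, ha, hamax⟩ := hA.exists_isGreatest hA0
  obtain ⟨b, hb, hbmin⟩ := hB.exists_isLeast hB0
  have h1 : (fun x => x + b) '' A ∪ (fun x => a + x) '' B ⊆ S := by
    rintro _ (⟨x, hx, rfl⟩ | ⟨x, hx, rfl⟩)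
    · exact hS x hx b hb
    · exact hS a ha x hx
  have h2 : volume ((fun x => x + b) '' A) = volume A := by simp
  have h3 : volume ((fun x => a + x) '' B) = volume B := by simp
  have h4 : AEDisjoint volume ((fun x => x + b) '' A) ((fun x => a + x) '' B) := by
    refine measure_mono_null (t := {a + b}) ?_ (by simp)
    rintro _ ⟨⟨x, hx, rfl⟩, ⟨y, hy, hxy⟩⟩
    have := hamax hx
    have := hbmin hy
    simp only [mem_singleton_iff] at *
    linarith
  have h5 : NullMeasurableSet ((fun x => a + x) '' B) volume :=
    ((hB.image (by fun_prop)).measurableSet).nullMeasurableSet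
  rw [← h2, ← h3, ← measure_union₀ h5 h4]
  exact measure_mono h1

theorem volume_add_volume_le {A B S : Set ℝ} (hA : MeasurableSet A) (hB : MeasurableSet B)
    (hA0 : A.Nonempty) (hB0 : B.Nonempty) (hS : ∀ a ∈ A, ∀ b ∈ B, a + b ∈ S) :
    volume A + volume B ≤ volume S := by
  obtain ⟨a, ha⟩ := hA0
  obtain ⟨b, hb⟩ := hB0
  have key : ∀ K₁ : Set ℝ, K₁ ⊆ A → IsCompact K₁ → ∀ K₂ : Set ℝ, K₂ ⊆ B → IsCompact K₂ →
      volume K₁ + volume K₂ ≤ volume S := by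
    intro K₁ h1 hc1 K₂ h2 hc2
    refine le_trans (add_le_add (measure_mono (subset_insert a K₁))
      (measure_mono (subset_insert b K₂))) ?_
    refine volume_add_volume_le_of_isCompact (hc1.insert a) (hc2.insert b)
      (insert_nonempty _ _) (insert_nonempty _ _) fun x hx y hy => hS x ?_ y ?_
    · exact insert_subset ha h1 hx
    · exact insert_subset hb h2 hy
  rw [hA.measure_eq_iSup_isCompact, hB.measure_eq_iSup_isCompact]
  simp only [iSup_and']
  exact ENNReal.biSup_add_biSup_le' ⟨∅, empty_subset _, isCompact_empty⟩
    ⟨∅, empty_subset _, isCompact_empty⟩ fun K₁ h1 K₂ h2 => key K₁ h1.1 h1.2 K₂ h2.1 h2.2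

/-- One-dimensional Prékopa–Leindler inequality for functions with supremum one. -/
theorem lintegral_add_lintegral_le_of_min_le {f g h : ℝ → ℝ} (hf : Measurable f) (hg : Measurable g)
    (hh : Measurable h) (hf0 : ∀ x, 0 ≤ f x) (hg0 : ∀ x, 0 ≤ g x) (hh0 : ∀ x, 0 ≤ h x)
    (hf1 : ∀ x, f x ≤ 1) (hg1 : ∀ x, g x ≤ 1)
    (hfs : ∀ t < 1, ∃ x, t < f x) (hgs : ∀ t < 1, ∃ x, t < g x)
    (H : ∀ x y, min (f x) (g y) ≤ h ((x + y) / 2)) :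
    (∫⁻ x, ENNReal.ofReal (f x)) + (∫⁻ x, ENNReal.ofReal (g x)) ≤
      2 * ∫⁻ x, ENNReal.ofReal (h x) := by
  rw [lintegral_eq_lintegral_meas_lt _ (ae_of_all _ hf0) hf.aemeasurable,
    lintegral_eq_lintegral_meas_lt _ (ae_of_all _ hg0) hg.aemeasurable,
    lintegral_eq_lintegral_meas_lt _ (ae_of_all _ hh0) hh.aemeasurable]
  have hanti : ∀ k : ℝ → ℝ, Measurable fun t => volume {a | t < k a} := fun k =>
    Antitone.measurable fun s t hst => measure_mono fun x hx => lt_of_le_of_lt hst hx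
  rw [← lintegral_add_left (hanti f), ← lintegral_const_mul _ (hanti h)]
  refine lintegral_mono fun t => ?_
  rcases lt_or_ge t 1 with ht | ht
  · have h1 : volume {a | t < f a} + volume {a | t < g a} ≤
        volume ((fun x => (2:ℝ) • x) '' {a | t < h a}) := by
      refine volume_add_volume_le (measurableSet_lt measurable_const hf)
        (measurableSet_lt measurable_const hg) (hfs t ht) (hgs t ht) fun a ha b hb => ?_
      exact ⟨(a + b) / 2, lt_of_lt_of_le (lt_min ha hb) (H a b), by simp only [smul_eq_mul]; ring⟩
    rw [image_smul, Measure.addHaar_smul] at h1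
    simpa using h1
  · have h1 : {a | t < f a} = ∅ := by
      ext x; simpa using (hf1 x).trans ht
    have h2 : {a | t < g a} = ∅ := by
      ext x; simpa using (hg1 x).trans ht
    simp [h1, h2]

theorem ENNReal.mul_le_sq_of_add_le_two_mul {I J K : ENNReal} (h : I + J ≤ 2 * K) : I * J ≤ K ^ 2 := by
  rcases eq_or_ne K ⊤ with rfl | hK
  · simp
  have hIJ : I + J ≠ ⊤ := ne_top_of_le_ne_top (ENNReal.mul_ne_top (by simp) hK) h
  have hI : I ≠ ⊤ := fun e => hIJ (by simp [e])
  have hJ : J ≠ ⊤ := fun e => hIJ (by simp [e])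
  lift I to NNReal using hI
  lift J to NNReal using hJ
  lift K to NNReal using hK
  norm_cast at h ⊢
  rw [← NNReal.coe_le_coe] at h ⊢
  push_cast at h ⊢
  nlinarith [sq_nonneg ((I:ℝ) - J), I.coe_nonneg, J.coe_nonneg, K.coe_nonneg]

theorem prekopa_leindler_real_of_bounded {f g h : ℝ → ENNReal} (hf : Measurable f)
    (hg : Measurable g) (hh : Measurable h) {M N : ENNReal} (hM : M ≠ ⊤) (hN : N ≠ ⊤)
    (hfM : ∀ x, f x ≤ M) (hgN : ∀ x, g x ≤ N)
    (H : ∀ x y, f x * g y ≤ h ((x + y) / 2) ^ 2) :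
    (∫⁻ x, f x) * (∫⁻ x, g x) ≤ (∫⁻ x, h x) ^ 2 := by
  set a := ⨆ x, f x with ha
  set b := ⨆ x, g x with hb
  have hfa : ∀ x, f x ≤ a := le_iSup f
  have hgb : ∀ x, g x ≤ b := le_iSup g
  have hat : a ≠ ⊤ := ne_top_of_le_ne_top hM (iSup_le hfM)
  have hbt : b ≠ ⊤ := ne_top_of_le_ne_top hN (iSup_le hgN)
  rcases eq_or_ne a 0 with ha0 | ha0
  · have : ∀ x, f x = 0 := fun x => by simpa [ha0] using hfa x
    simp [this]
  rcases eq_or_ne b 0 with hb0 | hb0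
  · have : ∀ x, g x = 0 := fun x => by simpa [hb0] using hgb x
    simp [this]
  set c : ENNReal := (a * b) ^ (1 / 2 : ℝ) with hc
  have hc2 : c ^ 2 = a * b := by
    rw [hc, ← ENNReal.rpow_natCast, ← ENNReal.rpow_mul]; norm_num
  have hab0 : a * b ≠ 0 := mul_ne_zero ha0 hb0
  have habt : a * b ≠ ⊤ := ENNReal.mul_ne_top hat hbt
  have hc0 : c ≠ 0 := by rintro e; rw [e] at hc2; simp at hc2; tauto
  have hct : c ≠ ⊤ := by rintro e; rw [e] at hc2; simp at hc2; exact habt hc2.symm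
  have hft : ∀ x, f x / a ≤ 1 := fun x => ENNReal.div_le_of_le_mul (by simpa using hfa x)
  have hgt : ∀ x, g x / b ≤ 1 := fun x => ENNReal.div_le_of_le_mul (by simpa using hgb x)
  have hsup : ∀ (k : ℝ → ENNReal) (d : ENNReal), d = ⨆ x, k x → d ≠ 0 → d ≠ ⊤ →
      (∀ x, k x / d ≤ 1) → ∀ t < (1:ℝ), ∃ x, t < (k x / d).toReal := by
    intro k d hd hd0 hdt hk1 t ht
    rcases lt_or_ge t 0 with h0 | h0
    · exact ⟨0, h0.trans_le ENNReal.toReal_nonneg⟩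
    have h1 : ENNReal.ofReal t * d < d := by
      conv_rhs => rw [← one_mul d]
      exact ENNReal.mul_lt_mul_left hd0 hdt (by simpa using ht)
    obtain ⟨x, hx⟩ := lt_iSup_iff.1 (h1.trans_eq hd)
    refine ⟨x, ?_⟩
    rw [← ENNReal.ofReal_lt_iff_lt_toReal h0 (ne_top_of_le_ne_top ENNReal.one_ne_top (hk1 x))]
    exact (ENNReal.lt_div_iff_mul_lt (Or.inl hd0) (Or.inl hdt)).2 hx
  have main := lintegral_add_lintegral_le_of_min_le
    (f := fun x => (f x / a).toReal) (g := fun x => (g x / b).toReal)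
    (h := fun x => (min (h x / c) 1).toReal)
    (hf.div_const a).ennreal_toReal (hg.div_const b).ennreal_toReal
    ((hh.div_const c).min measurable_const).ennreal_toReal
    (fun _ => ENNReal.toReal_nonneg) (fun _ => ENNReal.toReal_nonneg)
    (fun _ => ENNReal.toReal_nonneg)
    (fun x => by simpa using ENNReal.toReal_mono ENNReal.one_ne_top (hft x))
    (fun x => by simpa using ENNReal.toReal_mono ENNReal.one_ne_top (hgt x))
    (hsup f a ha ha0 hat hft) (hsup g b hb hb0 hbt hgt) ?_
  · have e1 : ∀ x, ENNReal.ofReal (f x / a).toReal = f x * a⁻¹ := fun x =>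
      ENNReal.ofReal_toReal (ne_top_of_le_ne_top ENNReal.one_ne_top (hft x))
    have e2 : ∀ x, ENNReal.ofReal (g x / b).toReal = g x * b⁻¹ := fun x =>
      ENNReal.ofReal_toReal (ne_top_of_le_ne_top ENNReal.one_ne_top (hgt x))
    have e3 : ∀ x, ENNReal.ofReal (min (h x / c) 1).toReal ≤ h x * c⁻¹ := fun x =>
      ENNReal.ofReal_toReal_le.trans (min_le_left _ _)
    simp only [e1, e2] at main
    have main' := main.trans (mul_le_mul_right (lintegral_mono e3) 2)
    rw [lintegral_mul_const _ hf, lintegral_mul_const _ hg, lintegral_mul_const _ hh] at main'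
    have := ENNReal.mul_le_sq_of_add_le_two_mul main'
    calc (∫⁻ x, f x) * (∫⁻ x, g x)
        = (a * a⁻¹) * (b * b⁻¹) * ((∫⁻ x, f x) * (∫⁻ x, g x)) := by
          rw [ENNReal.mul_inv_cancel ha0 hat, ENNReal.mul_inv_cancel hb0 hbt]; simp
      _ = (a * b) * (((∫⁻ x, f x) * a⁻¹) * ((∫⁻ x, g x) * b⁻¹)) := by ring
      _ ≤ c ^ 2 * ((∫⁻ x, h x) * c⁻¹) ^ 2 := by rw [hc2]; gcongr
      _ = (c * c⁻¹) ^ 2 * (∫⁻ x, h x) ^ 2 := by ring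
      _ = (∫⁻ x, h x) ^ 2 := by rw [ENNReal.mul_inv_cancel hc0 hct]; simp
  · intro x y
    rw [← ENNReal.toReal_min (ne_top_of_le_ne_top ENNReal.one_ne_top (hft x))
      (ne_top_of_le_ne_top ENNReal.one_ne_top (hgt y))]
    refine ENNReal.toReal_mono (by simp) (le_min ?_ ((min_le_left _ _).trans (hft x)))
    rw [← ENNReal.pow_le_pow_left_iff (n := 2) (by norm_num)]
    calc (min (f x / a) (g y / b)) ^ 2 ≤ (f x / a) * (g y / b) := by
          rw [sq]; exact mul_le_mul' (min_le_left _ _) (min_le_right _ _)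
      _ = f x * g y * (a * b)⁻¹ := by
          rw [ENNReal.mul_inv (Or.inl ha0) (Or.inl hat), div_eq_mul_inv, div_eq_mul_inv]; ring
      _ ≤ h ((x + y) / 2) ^ 2 * (c ^ 2)⁻¹ := by rw [hc2]; gcongr; exact H x y
      _ = (h ((x + y) / 2) / c) ^ 2 := by
          rw [div_eq_mul_inv (h _), mul_pow, ENNReal.inv_pow]

theorem lintegral_eq_iSup_lintegral_min_natCast {α : Type*} [MeasurableSpace α] (ν : Measure α)
    {f : α → ENNReal} (hf : Measurable f) : ∫⁻ x, f x ∂ν = ⨆ k : ℕ, ∫⁻ x, min (f x) k ∂ν := by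
  rw [← lintegral_iSup (fun k => hf.min measurable_const)]
  · refine lintegral_congr fun x => ?_
    rw [← inf_iSup_eq, ENNReal.iSup_natCast, inf_top_eq]
  · intro i j hij x
    exact min_le_min le_rfl (by exact_mod_cast hij)

/-- Midpoint Prékopa–Leindler inequality on the line. -/
theorem prekopa_leindler_real {f g h : ℝ → ENNReal} (hf : Measurable f)
    (hg : Measurable g) (hh : Measurable h)
    (H : ∀ x y, f x * g y ≤ h ((x + y) / 2) ^ 2) :
    (∫⁻ x, f x) * (∫⁻ x, g x) ≤ (∫⁻ x, h x) ^ 2 := by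
  rw [lintegral_eq_iSup_lintegral_min_natCast _ hf, lintegral_eq_iSup_lintegral_min_natCast _ hg]
  simp only [ENNReal.iSup_mul, ENNReal.mul_iSup, iSup_le_iff]
  intro i j
  exact prekopa_leindler_real_of_bounded (hf.min measurable_const) (hg.min measurable_const) hh
    (ENNReal.natCast_ne_top _) (ENNReal.natCast_ne_top _) (fun _ => min_le_right _ _)
    (fun _ => min_le_right _ _)
    fun x y => (mul_le_mul' (min_le_left _ _) (min_le_left _ _)).trans (H x y)

theorem lintegral_pi_succ {n : ℕ} {f : (Fin (n + 1) → ℝ) → ENNReal} (hf : Measurable f) :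
    ∫⁻ x, f x = ∫⁻ y : Fin n → ℝ, ∫⁻ t : ℝ, f (Fin.cons t y) := by
  have e := (volume_preserving_piFinSuccAbove (fun _ : Fin (n + 1) => ℝ) 0).symm
  rw [← e.lintegral_comp hf, Measure.volume_eq_prod]
  refine (lintegral_prod_symm' (μ := (volume : Measure ℝ)) (ν := (volume : Measure (Fin n → ℝ))) _
    (hf.comp e.measurable)).trans (lintegral_congr fun y => lintegral_congr fun t => ?_)
  change f (Fin.insertNth 0 t y) = _
  rw [Fin.insertNth_zero']

/-- Midpoint Prékopa–Leindler inequality on `Fin n → ℝ`. -/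
theorem prekopa_leindler_pi {n : ℕ} {f g h : (Fin n → ℝ) → ENNReal} (hf : Measurable f)
    (hg : Measurable g) (hh : Measurable h)
    (H : ∀ x y, f x * g y ≤ h ((1 / 2 : ℝ) • (x + y)) ^ 2) :
    (∫⁻ x, f x) * (∫⁻ x, g x) ≤ (∫⁻ x, h x) ^ 2 := by
  induction n with
  | zero =>
    have hi : ∀ k : (Fin 0 → ℝ) → ENNReal, ∫⁻ x, k x = k default := fun k => by
      rw [lintegral_unique, volume_pi, Measure.pi_empty_univ, mul_one]
      exact congrArg k (Subsingleton.elim _ _)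
    rw [hi, hi, hi]
    exact (H default default).trans_eq (by rw [Subsingleton.elim ((1 / 2 : ℝ) • _) default])
  | succ n ih =>
    rw [lintegral_pi_succ hf, lintegral_pi_succ hg, lintegral_pi_succ hh]
    have hcons : Measurable fun p : (Fin n → ℝ) × ℝ => (Fin.cons p.2 p.1 : Fin (n + 1) → ℝ) := by
      refine measurable_pi_lambda _ fun i => ?_
      refine Fin.cases ?_ (fun i => ?_) i
      · simpa using measurable_snd
      · simpa [Function.comp_def] using (measurable_pi_apply i).comp measurable_fst
    have hm : ∀ {k : (Fin (n + 1) → ℝ) → ENNReal}, Measurable k →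
        Measurable fun y : Fin n → ℝ => ∫⁻ t : ℝ, k (Fin.cons t y) := fun hk =>
      (hk.comp hcons).lintegral_prod_right'
    have hs : ∀ {k : (Fin (n + 1) → ℝ) → ENNReal}, Measurable k → ∀ y : Fin n → ℝ,
        Measurable fun t : ℝ => k (Fin.cons t y) := fun hk y =>
      (hk.comp hcons).comp measurable_prodMk_left
    refine ih (hm hf) (hm hg) (hm hh) fun y z => ?_
    refine prekopa_leindler_real (hs hf y) (hs hg z) (hs hh _) fun s t => ?_
    convert H (Fin.cons s y) (Fin.cons t z) using 3
    ext i
    refine Fin.cases ?_ (fun i => ?_) i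
    · simp; ring
    · simp; ring

/-- Midpoint Prékopa–Leindler inequality on Euclidean space. -/
theorem prekopa_leindler {n : ℕ} {f g h : EucSp n → ENNReal} (hf : Measurable f)
    (hg : Measurable g) (hh : Measurable h)
    (H : ∀ x y, f x * g y ≤ h ((1 / 2 : ℝ) • (x + y)) ^ 2) :
    (∫⁻ x, f x) * (∫⁻ x, g x) ≤ (∫⁻ x, h x) ^ 2 := by
  have e := PiLp.volume_preserving_toLp (Fin n)
  rw [← e.lintegral_comp hf, ← e.lintegral_comp hg, ← e.lintegral_comp hh]
  refine prekopa_leindler_pi (hf.comp e.measurable) (hg.comp e.measurable) (hh.comp e.measurable)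
    fun x y => ?_
  exact H (WithLp.toLp 2 x) (WithLp.toLp 2 y)

theorem IsLogConcaveFn.mul {n : ℕ} {f g : EucSp n → ℝ} (hf : IsLogConcaveFn f)
    (hg : IsLogConcaveFn g) : IsLogConcaveFn fun x => f x * g x := by
  refine ⟨fun x => mul_nonneg (hf.1 x) (hg.1 x), fun x y l hl => ?_⟩
  rw [Real.mul_rpow (hf.1 x) (hg.1 x), Real.mul_rpow (hf.1 y) (hg.1 y), mul_mul_mul_comm]
  exact mul_le_mul (hf.2 x y l hl) (hg.2 x y l hl)
    (mul_nonneg (Real.rpow_nonneg (hg.1 x) _) (Real.rpow_nonneg (hg.1 y) _)) (hf.1 _)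

theorem isLogConcaveFn_const {n : ℕ} {c : ℝ} (hc : 0 < c) :
    IsLogConcaveFn fun _ : EucSp n => c := by
  refine ⟨fun _ => hc.le, fun x y l hl => ?_⟩
  rw [← Real.rpow_add hc]; simp

theorem isLogConcaveFn_exp_inner {n : ℕ} (ξ : EucSp n) :
    IsLogConcaveFn fun x : EucSp n => Real.exp ⟪ξ, x⟫ := by
  refine ⟨fun _ => (Real.exp_pos _).le, fun x y l hl => ?_⟩
  simp only
  rw [← Real.exp_mul, ← Real.exp_mul, ← Real.exp_add, inner_add_right, inner_smul_right,
    inner_smul_right, mul_comm (1 - l), mul_comm l]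

theorem isLogConcaveFn_indicator {n : ℕ} {A : Set (EucSp n)} (hA : Convex ℝ A) :
    IsLogConcaveFn (A.indicator fun _ => (1 : ℝ)) := by
  refine ⟨fun x => indicator_nonneg (fun _ _ => zero_le_one) x, fun x y l hl => ?_⟩
  rcases eq_or_ne l 0 with rfl | h0
  · simp
  rcases eq_or_ne l 1 with rfl | h1
  · simp
  by_cases hx : x ∈ A
  · by_cases hy : y ∈ A
    · have : (1 - l) • x + l • y ∈ A := hA hx hy (by linarith [hl.2]) hl.1 (by ring)
      simp [hx, hy, this]
    · simp only [indicator_of_notMem hy, Real.zero_rpow h0, mul_zero]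
      exact indicator_nonneg (fun _ _ => zero_le_one) _
  · simp only [indicator_of_notMem hx, Real.zero_rpow (sub_ne_zero.2 h1.symm), zero_mul]
    exact indicator_nonneg (fun _ _ => zero_le_one) _

theorem IsLogConcaveFn.convex_pos {n : ℕ} {f : EucSp n → ℝ} (hf : IsLogConcaveFn f) :
    Convex ℝ {x | 0 < f x} := by
  intro x hx y hy a b ha hb hab
  have h := hf.2 x y b ⟨hb, by linarith⟩
  rw [show 1 - b = a by linarith] at h
  exact (mul_pos (Real.rpow_pos_of_pos hx _) (Real.rpow_pos_of_pos hy _)).trans_le h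

theorem IsLogConcaveFn.mul_le_sq {n : ℕ} {f : EucSp n → ℝ} (hf : IsLogConcaveFn f)
    (x y : EucSp n) : f x * f y ≤ f ((1 / 2 : ℝ) • (x + y)) ^ 2 := by
  have h := hf.2 x y (1 / 2) ⟨by norm_num, by norm_num⟩
  rw [show (1 : ℝ) - 1 / 2 = 1 / 2 by norm_num, ← Real.sqrt_eq_rpow, ← Real.sqrt_eq_rpow,
    ← smul_add] at h
  calc f x * f y = (√(f x) * √(f y)) ^ 2 := by
        rw [mul_pow, Real.sq_sqrt (hf.1 x), Real.sq_sqrt (hf.1 y)]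
    _ ≤ _ := pow_le_pow_left₀ (by positivity) h 2

theorem IsLogConcaveFn.continuousOn {n : ℕ} {f : EucSp n → ℝ} (hf : IsLogConcaveFn f) :
    ContinuousOn f (interior {x | 0 < f x}) := by
  have hc : ConcaveOn ℝ {x | 0 < f x} fun x => Real.log (f x) := by
    refine ⟨hf.convex_pos, fun x hx y hy a b ha hb hab => ?_⟩
    have h := hf.2 x y b ⟨hb, by linarith⟩
    rw [show 1 - b = a by linarith] at h
    have hxa := Real.rpow_pos_of_pos hx a
    have hyb := Real.rpow_pos_of_pos hy b
    have := Real.log_le_log (mul_pos hxa hyb) h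
    rwa [Real.log_mul hxa.ne' hyb.ne', Real.log_rpow hx, Real.log_rpow hy] at this
  refine hc.continuousOn_interior.rexp.congr fun x hx => ?_
  have h : x ∈ {x | 0 < f x} := interior_subset hx
  exact (Real.exp_log h).symm

/-- A log-concave measure has a measurable log-concave density whose positivity set is open. -/
theorem IsLogConcave.exists_measurable_density {n : ℕ} {μ : Measure (EucSp n)}
    (hμ : IsLogConcave μ) : ∃ f : EucSp n → ℝ, IsLogConcaveFn f ∧ Measurable f ∧
      IsOpen {x | 0 < f x} ∧ μ = volume.withDensity fun x => ENNReal.ofReal (f x) := by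
  obtain ⟨f, hf, rfl⟩ := hμ
  set U := interior {x | 0 < f x} with hU
  have hfU : (fun x => U.indicator f x) = fun x => f x * U.indicator (fun _ => 1) x := by
    ext x; by_cases h : x ∈ U <;> simp [h]
  refine ⟨U.indicator f, ?_, ?_, ?_, ?_⟩
  · rw [show U.indicator f = fun x => U.indicator f x from rfl, hfU]
    exact hf.mul (isLogConcaveFn_indicator hf.convex_pos.interior)
  · classical
    rw [← piecewise_eq_indicator]
    exact hf.continuousOn.measurable_piecewise continuousOn_const isOpen_interior.measurableSet
  · convert isOpen_interior (s := {x | 0 < f x}) using 1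
    ext x
    by_cases h : x ∈ U
    · have h' : x ∈ {x | 0 < f x} := interior_subset h
      have : 0 < f x := h'
      simp [h, this, ← hU]
    · simp [h, ← hU]
  · refine withDensity_congr_ae ?_
    have h0 := hf.convex_pos.addHaar_frontier volume
    filter_upwards [measure_eq_zero_iff_ae_notMem.1 h0] with x hx
    by_cases h : x ∈ U
    · simp [h]
    · have : ¬ 0 < f x := fun h1 => hx ⟨subset_closure h1, h⟩
      have : f x = 0 := le_antisymm (not_lt.1 this) (hf.1 x)
      simp [h, this]

theorem IsEvenMeasure.map_neg {n : ℕ} {μ : Measure (EucSp n)} (he : IsEvenMeasure μ) :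
    μ.map Neg.neg = μ := by
  ext A hA
  rw [Measure.map_apply measurable_neg hA]
  exact (he A hA).symm

theorem lintegral_le_two_mul_lintegral_indicator {n : ℕ} {μ : Measure (EucSp n)}
    (he : IsEvenMeasure μ) (θ : EucSp n) {g : EucSp n → ENNReal} (hg : Measurable g)
    (hge : ∀ x, g (-x) = g x) :
    ∫⁻ x, g x ∂μ ≤ 2 * ∫⁻ x, {x | 0 ≤ ⟪x, θ⟫}.indicator g x ∂μ := by
  have hS : MeasurableSet {x : EucSp n | 0 ≤ ⟪x, θ⟫} :=
    measurableSet_le measurable_const (by fun_prop)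
  have h1 : ∫⁻ x, {x | 0 ≤ ⟪x, θ⟫}.indicator g (-x) ∂μ =
      ∫⁻ x, {x | 0 ≤ ⟪x, θ⟫}.indicator g x ∂μ := by
    conv_rhs => rw [← he.map_neg]
    rw [lintegral_map (hg.indicator hS) measurable_neg]
  rw [two_mul]
  nth_rewrite 1 [← h1]
  rw [← lintegral_add_right _ (hg.indicator hS)]
  refine lintegral_mono fun x => ?_
  rcases le_total 0 ⟪x, θ⟫ with h | h
  · have : x ∈ {x | 0 ≤ ⟪x, θ⟫} := h
    rw [indicator_of_mem this]; exact le_add_self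
  · have : -x ∈ {x | 0 ≤ ⟪x, θ⟫} := by simpa using h
    rw [indicator_of_mem this, hge]; exact le_self_add

/-- Reverse Hölder inequality for linear functionals under an even log-concave measure. -/
theorem lintegral_inner_pow_four_le {n : ℕ} {μ : Measure (EucSp n)} [IsProbabilityMeasure μ]
    (hμ : IsLogConcave μ) (he : IsEvenMeasure μ) (θ : EucSp n) :
    ∫⁻ x, ENNReal.ofReal (⟪x, θ⟫ ^ 4) ∂μ ≤
      64 * (∫⁻ x, ENNReal.ofReal (⟪x, θ⟫ ^ 2) ∂μ) ^ 2 := by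
  obtain ⟨f, hf, hfm, -, hfμ⟩ := hμ.exists_measurable_density
  set S := {x : EucSp n | 0 ≤ ⟪x, θ⟫} with hSdef
  have hS : MeasurableSet S := measurableSet_le measurable_const (by fun_prop)
  have hInt : ∀ g : EucSp n → ENNReal, Measurable g →
      ∫⁻ x, g x ∂μ = ∫⁻ x, ENNReal.ofReal (f x) * g x := by
    intro g hg
    rw [hfμ, lintegral_withDensity_eq_lintegral_mul _ hfm.ennreal_ofReal hg]
    rfl
  have m4 : Measurable fun x : EucSp n => ENNReal.ofReal (⟪x, θ⟫ ^ 4) := by fun_prop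
  have m2 : Measurable fun x : EucSp n => ENNReal.ofReal (4 * ⟪x, θ⟫ ^ 2) := by fun_prop
  have hPL := prekopa_leindler
    (f := fun x => ENNReal.ofReal (f x) * S.indicator (fun _ => 1) x)
    (g := fun x => ENNReal.ofReal (f x) * S.indicator (fun x => ENNReal.ofReal (⟪x, θ⟫ ^ 4)) x)
    (h := fun x => ENNReal.ofReal (f x) * ENNReal.ofReal (4 * ⟪x, θ⟫ ^ 2))
    (hfm.ennreal_ofReal.mul (measurable_const.indicator hS))
    (hfm.ennreal_ofReal.mul (m4.indicator hS)) (hfm.ennreal_ofReal.mul m2) ?_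
  · rw [← hInt _ (measurable_const.indicator hS), ← hInt _ (m4.indicator hS), ← hInt _ m2] at hPL
    have h1 := lintegral_le_two_mul_lintegral_indicator he θ (g := fun _ => 1) measurable_const
      fun _ => rfl
    have h4 := lintegral_le_two_mul_lintegral_indicator he θ m4 fun x => by
      rw [inner_neg_left]; ring_nf
    rw [lintegral_const, measure_univ, one_mul] at h1
    have e2 : ∫⁻ x, ENNReal.ofReal (4 * ⟪x, θ⟫ ^ 2) ∂μ =
        4 * ∫⁻ x, ENNReal.ofReal (⟪x, θ⟫ ^ 2) ∂μ := by
      rw [← lintegral_const_mul _ (by fun_prop)]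
      refine lintegral_congr fun x => ?_
      rw [ENNReal.ofReal_mul (by norm_num)]; simp
    rw [e2] at hPL
    calc ∫⁻ x, ENNReal.ofReal (⟪x, θ⟫ ^ 4) ∂μ
        = 1 * ∫⁻ x, ENNReal.ofReal (⟪x, θ⟫ ^ 4) ∂μ := (one_mul _).symm
      _ ≤ _ := mul_le_mul' h1 h4
      _ = 4 * ((∫⁻ x, S.indicator (fun _ => 1) x ∂μ) *
          ∫⁻ x, S.indicator (fun x => ENNReal.ofReal (⟪x, θ⟫ ^ 4)) x ∂μ) := by ring
      _ ≤ 4 * (4 * ∫⁻ x, ENNReal.ofReal (⟪x, θ⟫ ^ 2) ∂μ) ^ 2 := by gcongr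
      _ = _ := by ring
  · intro x y
    by_cases hx : x ∈ S
    · by_cases hy : y ∈ S
      · have h1 := hf.mul_le_sq x y
        rw [indicator_of_mem hx, indicator_of_mem hy, mul_one,
          ← ENNReal.ofReal_mul (hf.1 y), ← ENNReal.ofReal_mul (hf.1 x),
          ← ENNReal.ofReal_mul (hf.1 _), ← ENNReal.ofReal_pow
            (mul_nonneg (hf.1 _) (by positivity))]
        refine ENNReal.ofReal_le_ofReal ?_
        have hx' : 0 ≤ ⟪x, θ⟫ := hx
        have hy' : 0 ≤ ⟪y, θ⟫ := hy
        rw [inner_smul_left, inner_add_left]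
        simp only [conj_trivial]
        calc f x * (f y * ⟪y, θ⟫ ^ 4) = (f x * f y) * ⟪y, θ⟫ ^ 4 := by ring
          _ ≤ f ((1 / 2 : ℝ) • (x + y)) ^ 2 * (⟪x, θ⟫ + ⟪y, θ⟫) ^ 4 := by
            gcongr
            linarith
          _ = _ := by ring
      · simp [hy]
    · simp [hx]

theorem integrable_of_compact_support {n : ℕ} {F : Type*} [NormedAddCommGroup F]
    {ν : Measure (EucSp n)} [IsFiniteMeasure ν] {K : Set (EucSp n)} (hK : IsCompact K)
    (hν : ν Kᶜ = 0) {g : EucSp n → F} (hg : Continuous g) : Integrable g ν := by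
  have h : ν.restrict K = ν := Measure.restrict_eq_self_of_ae_mem (by simpa [mem_ae_iff] using hν)
  rw [← h]
  exact hg.continuousOn.integrableOn_compact hK

theorem IsLogConcave.withDensity {n : ℕ} {μ : Measure (EucSp n)} (hμ : IsLogConcave μ)
    {w : EucSp n → ℝ} (hw : IsLogConcaveFn w) (hwm : Measurable w) :
    IsLogConcave (μ.withDensity fun x => ENNReal.ofReal (w x)) := by
  obtain ⟨f, hf, hfm, -, rfl⟩ := hμ.exists_measurable_density
  refine ⟨fun x => f x * w x, hf.mul hw, ?_⟩
  rw [← withDensity_mul _ hfm.ennreal_ofReal hwm.ennreal_ofReal]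
  congr 1
  ext x
  simp [ENNReal.ofReal_mul (hf.1 x)]

theorem IsLogConcave.cond {n : ℕ} {μ : Measure (EucSp n)} [IsFiniteMeasure μ] (hμ : IsLogConcave μ)
    {A : Set (EucSp n)} (hA : Convex ℝ A) (hAm : MeasurableSet A) (hA0 : μ A ≠ 0) :
    IsLogConcave (ProbabilityTheory.cond μ A) := by
  have hc : 0 < (μ A)⁻¹.toReal :=
    ENNReal.toReal_pos (by simp) (by simpa using hA0)
  have h := hμ.withDensity ((isLogConcaveFn_indicator hA).mul (isLogConcaveFn_const hc))
    ((measurable_const.indicator hAm).mul measurable_const)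
  convert h using 1
  rw [ProbabilityTheory.cond, ← withDensity_const,
    ← withDensity_indicator hAm]
  congr 1
  ext x
  by_cases hx : x ∈ A
  · simp only [indicator_of_mem hx, one_mul]
    rw [ENNReal.ofReal_toReal (by simpa using hA0)]
  · simp [hx]

theorem IsIsotropic.integral_inner_sq {n : ℕ} {μ : Measure (EucSp n)} (h : IsIsotropic μ)
    (θ : EucSp n) : ∫ x, ⟪x, θ⟫ ^ 2 ∂μ = ‖θ‖ ^ 2 := by
  simpa only [← sq, real_inner_self_eq_norm_sq] using h.2 θ θ

theorem norm_sq_eq_sum_inner_sq {n : ℕ} (x : EucSp n) :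
    ‖x‖ ^ 2 = ∑ i, ⟪x, EuclideanSpace.single i 1⟫ ^ 2 := by
  simp [EuclideanSpace.norm_sq_eq, EuclideanSpace.inner_single_right]

/-- Truncating an even isotropic log-concave measure to a ball of radius `16 √n` keeps at least half
of its second moment in every direction. -/
theorem half_norm_sq_le_setIntegral_inner_sq {n : ℕ} (hn : 1 ≤ n) {μ : Measure (EucSp n)}
    [IsProbabilityMeasure μ] (hμ : IsLogConcave μ) (he : IsEvenMeasure μ) (hi : IsIsotropic μ)
    {K : Set (EucSp n)} (hK : IsCompact K) (hμK : μ Kᶜ = 0) (θ : EucSp n) :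
    ‖θ‖ ^ 2 / 2 ≤ ∫ x in Metric.closedBall 0 (16 * √n), ⟪x, θ⟫ ^ 2 ∂μ := by
  rcases eq_or_ne θ 0 with rfl | hθ
  · simp
  set m := ‖θ‖ ^ 2 with hm
  have hm0 : 0 < m := by positivity
  set A := Metric.closedBall (0 : EucSp n) (16 * √n)
  have hA : MeasurableSet A := Metric.isClosed_closedBall.measurableSet
  have hn0 : (0 : ℝ) < n := by exact_mod_cast hn
  have i2 : Integrable (fun x => ⟪x, θ⟫ ^ 2) μ := integrable_of_compact_support hK hμK (by fun_prop)
  have i4 : Integrable (fun x => ⟪x, θ⟫ ^ 4) μ := integrable_of_compact_support hK hμK (by fun_prop)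
  have iN : Integrable (fun x => ‖x‖ ^ 2) μ := integrable_of_compact_support hK hμK (by fun_prop)
  have e2 : ∫ x, ⟪x, θ⟫ ^ 2 ∂μ = m := hi.integral_inner_sq θ
  have eN : ∫ x, ‖x‖ ^ 2 ∂μ = n := by
    simp_rw [norm_sq_eq_sum_inner_sq]
    rw [integral_finsetSum _ fun i _ => integrable_of_compact_support hK hμK (by fun_prop)]
    simp [hi.integral_inner_sq]
  have e4 : ∫ x, ⟪x, θ⟫ ^ 4 ∂μ ≤ 64 * m ^ 2 := by
    have h := lintegral_inner_pow_four_le hμ he θ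
    rw [← ofReal_integral_eq_lintegral_ofReal i4 (ae_of_all _ fun x => by positivity),
      ← ofReal_integral_eq_lintegral_ofReal i2 (ae_of_all _ fun x => by positivity), e2,
      ← ENNReal.ofReal_pow hm0.le, show (64 : ENNReal) = ENNReal.ofReal 64 by simp,
      ← ENNReal.ofReal_mul (by norm_num)] at h
    exact (ENNReal.ofReal_le_ofReal_iff (by positivity)).1 h
  have hpt : ∀ x, ⟪x, θ⟫ ^ 2 ≤ A.indicator (fun x => ⟪x, θ⟫ ^ 2) x +
      (⟪x, θ⟫ ^ 4 / (256 * m) + m / (4 * n) * ‖x‖ ^ 2) := by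
    intro x
    by_cases hx : x ∈ A
    · rw [indicator_of_mem hx]
      have : 0 ≤ ⟪x, θ⟫ ^ 4 / (256 * m) + m / (4 * n) * ‖x‖ ^ 2 := by positivity
      linarith
    · rw [indicator_of_notMem hx]
      have hx' : 16 * √n < ‖x‖ := by simpa [A] using hx
      have h1 : 256 * (n : ℝ) ≤ ‖x‖ ^ 2 := by
        have := pow_le_pow_left₀ (by positivity) hx'.le 2
        rwa [mul_pow, Real.sq_sqrt hn0.le, show (16 : ℝ) ^ 2 = 256 by norm_num] at this
      have h2 : 64 * m ≤ m / (4 * n) * ‖x‖ ^ 2 := by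
        calc 64 * m = m / (4 * n) * (256 * n) := by field_simp; norm_num
          _ ≤ _ := by gcongr
      have h3 : ⟪x, θ⟫ ^ 2 - 64 * m ≤ ⟪x, θ⟫ ^ 4 / (256 * m) := by
        rw [le_div_iff₀ (by positivity)]
        nlinarith [sq_nonneg (⟪x, θ⟫ ^ 2 - 128 * m)]
      linarith
  have iR : Integrable (fun x => ⟪x, θ⟫ ^ 4 / (256 * m) + m / (4 * n) * ‖x‖ ^ 2) μ :=
    (i4.div_const _).add (iN.const_mul _)
  have h : ∫ x, ⟪x, θ⟫ ^ 2 ∂μ ≤ ∫ x, (A.indicator (fun x => ⟪x, θ⟫ ^ 2) x +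
      (⟪x, θ⟫ ^ 4 / (256 * m) + m / (4 * n) * ‖x‖ ^ 2)) ∂μ :=
    integral_mono i2 ((i2.indicator hA).add iR) hpt
  rw [integral_add (i2.indicator hA) iR,
    integral_add (i4.div_const _) (iN.const_mul _), integral_indicator hA, e2, integral_div,
    integral_const_mul, eN] at h
  have h5 : (∫ x, ⟪x, θ⟫ ^ 4 ∂μ) / (256 * m) ≤ m / 4 := by
    rw [div_le_iff₀ (by positivity)]; nlinarith
  have h6 : m / (4 * n) * n = m / 4 := by field_simp
  linarith

theorem IsEvenMeasure.integral_id_eq_zero {n : ℕ} {μ : Measure (EucSp n)} (he : IsEvenMeasure μ) :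
    ∫ x, x ∂μ = 0 := by
  have h : ∫ x, x ∂μ = -∫ x, x ∂μ := by
    conv_lhs => rw [← he.map_neg]
    rw [integral_map (f := fun x => x) measurable_neg.aemeasurable aestronglyMeasurable_id,
      integral_neg]
  have h2 : (2 : ℝ) • ∫ x, x ∂μ = 0 := by
    rw [two_smul]
    nth_rewrite 1 [h]
    exact neg_add_cancel _
  simpa using h2

theorem IsEvenMeasure.cond {n : ℕ} {μ : Measure (EucSp n)} (he : IsEvenMeasure μ)
    {A : Set (EucSp n)} (hA : MeasurableSet A) (hAe : -A = A) :
    IsEvenMeasure (ProbabilityTheory.cond μ A) := by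
  intro B hB
  rw [ProbabilityTheory.cond_apply hA, ProbabilityTheory.cond_apply hA, he (A ∩ B) (hA.inter hB),
    Set.inter_neg, hAe]

/-- The exponential tilt of a measure in direction `ξ`. -/
def expTilt {n : ℕ} (ν : Measure (EucSp n)) (ξ : EucSp n) : Measure (EucSp n) :=
  ν.tilted fun x => ⟪ξ, x⟫

/-- The barycenter of the exponential tilt. -/
def tiltBary {n : ℕ} (ν : Measure (EucSp n)) (ξ : EucSp n) : EucSp n :=
  ∫ x, x ∂(expTilt ν ξ)

/-- The covariance matrix of the exponential tilt. -/
def tiltCov {n : ℕ} (ν : Measure (EucSp n)) (ξ : EucSp n) : Matrix (Fin n) (Fin n) ℝ :=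
  Matrix.of fun i j => ∫ x, x i * x j ∂(expTilt ν ξ) -
    (∫ x, x i ∂(expTilt ν ξ)) * ∫ x, x j ∂(expTilt ν ξ)

theorem expTilt_absolutelyContinuous {n : ℕ} (ν : Measure (EucSp n)) (ξ : EucSp n) :
    expTilt ν ξ ≪ ν := tilted_absolutelyContinuous _ _

theorem expTilt_zero {n : ℕ} (ν : Measure (EucSp n)) [IsProbabilityMeasure ν] :
    expTilt ν 0 = ν := by
  simp [expTilt]

theorem isProbabilityMeasure_expTilt {n : ℕ} {ν : Measure (EucSp n)} [IsProbabilityMeasure ν]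
    {K : Set (EucSp n)} (hK : IsCompact K) (hν : ν Kᶜ = 0) (ξ : EucSp n) :
    IsProbabilityMeasure (expTilt ν ξ) :=
  isProbabilityMeasure_tilted (integrable_of_compact_support hK hν (by fun_prop))

theorem hasFDerivAt_integral_exp_inner_mul {n : ℕ} {ν : Measure (EucSp n)} [IsFiniteMeasure ν]
    {K : Set (EucSp n)} (hK : IsCompact K) (hν : ν Kᶜ = 0) {g : EucSp n → ℝ} (hg : Continuous g)
    (ξ : EucSp n) :
    ∃ D : EucSp n →L[ℝ] ℝ, HasFDerivAt (fun ξ => ∫ x, Real.exp ⟪ξ, x⟫ * g x ∂ν) D ξ ∧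
      ∀ η, D η = ∫ x, Real.exp ⟪ξ, x⟫ * (g x * ⟪x, η⟫) ∂ν := by
  have hc : Continuous fun x => (Real.exp ⟪ξ, x⟫ * g x) • innerSL ℝ x := by fun_prop
  refine ⟨∫ x, (Real.exp ⟪ξ, x⟫ * g x) • innerSL ℝ x ∂ν, ?_, fun η => ?_⟩
  · refine hasFDerivAt_integral_of_dominated_of_fderiv_le
      (F := fun ξ x => Real.exp ⟪ξ, x⟫ * g x)
      (F' := fun ξ x => (Real.exp ⟪ξ, x⟫ * g x) • innerSL ℝ x)
      (s := Metric.ball ξ 1)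
      (bound := fun x => Real.exp ((‖ξ‖ + 1) * ‖x‖) * |g x| * ‖x‖)
      (Metric.ball_mem_nhds ξ one_pos) (Eventually.of_forall fun ξ => ?_)
      (integrable_of_compact_support hK hν (by fun_prop)) hc.aestronglyMeasurable
      (ae_of_all _ fun x ζ hζ => ?_) (integrable_of_compact_support hK hν (by fun_prop))
      (ae_of_all _ fun x ζ hζ => ?_)
    · exact Continuous.aestronglyMeasurable (by fun_prop)
    · rw [norm_smul, innerSL_apply_norm, norm_mul, Real.norm_eq_abs, Real.norm_eq_abs,
        Real.abs_exp]
      have h1 : ‖ζ‖ ≤ ‖ξ‖ + 1 := by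
        have := norm_le_norm_add_norm_sub' ζ ξ
        have h2 : ‖ζ - ξ‖ < 1 := by simpa [dist_eq_norm] using hζ
        linarith
      have h2 : ⟪ζ, x⟫ ≤ (‖ξ‖ + 1) * ‖x‖ := (real_inner_le_norm _ _).trans (by gcongr)
      gcongr
    · have h1 : HasFDerivAt (fun ζ : EucSp n => ⟪ζ, x⟫) (innerSL ℝ x) ζ := by
        have := (innerSL ℝ x).hasFDerivAt (x := ζ)
        refine this.congr_of_eventuallyEq (Eventually.of_forall fun z => ?_)
        simp [real_inner_comm]
      refine (h1.exp.mul_const (g x)).congr_fderiv ?_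
      rw [smul_smul, mul_comm]
  · rw [ContinuousLinearMap.integral_apply (integrable_of_compact_support hK hν hc)]
    refine integral_congr_ae (ae_of_all _ fun x => ?_)
    simp [mul_assoc]

theorem integral_expTilt {n : ℕ} (ν : Measure (EucSp n)) (ξ : EucSp n) (g : EucSp n → ℝ) :
    ∫ x, g x ∂(expTilt ν ξ) =
      (∫ x, Real.exp ⟪ξ, x⟫ * g x ∂ν) / ∫ x, Real.exp ⟪ξ, x⟫ * 1 ∂ν := by
  rw [expTilt, integral_tilted, ← integral_div]
  simp only [smul_eq_mul, mul_one]
  refine integral_congr_ae (ae_of_all _ fun x => ?_)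
  ring

/-- Differentiating the expectation of `g` under the tilt gives a covariance. -/
theorem hasFDerivAt_integral_expTilt {n : ℕ} {ν : Measure (EucSp n)} [IsProbabilityMeasure ν]
    {K : Set (EucSp n)} (hK : IsCompact K) (hν : ν Kᶜ = 0) {g : EucSp n → ℝ} (hg : Continuous g)
    (ξ : EucSp n) :
    ∃ D : EucSp n →L[ℝ] ℝ, HasFDerivAt (fun ξ => ∫ x, g x ∂(expTilt ν ξ)) D ξ ∧
      ∀ η, D η = ∫ x, g x * ⟪x, η⟫ ∂(expTilt ν ξ) -
        (∫ x, g x ∂(expTilt ν ξ)) * ∫ x, ⟪x, η⟫ ∂(expTilt ν ξ) := by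
  obtain ⟨D, hD, hDη⟩ := hasFDerivAt_integral_exp_inner_mul hK hν hg ξ
  obtain ⟨D₁, hD₁, hDη₁⟩ := hasFDerivAt_integral_exp_inner_mul hK hν
    (g := fun _ => (1 : ℝ)) continuous_const ξ
  have hZ : 0 < ∫ x, Real.exp ⟪ξ, x⟫ * 1 ∂ν := by
    simp only [mul_one]
    exact integral_exp_pos (integrable_of_compact_support hK hν (by fun_prop))
  simp only [integral_expTilt, div_eq_mul_inv]
  refine ⟨_, hD.mul ((hasDerivAt_inv hZ.ne').comp_hasFDerivAt ξ hD₁), fun η => ?_⟩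
  simp only [one_mul] at hDη₁
  set Z := ∫ x, Real.exp ⟪ξ, x⟫ * 1 ∂ν
  simp [hDη, hDη₁]
  field_simp
  ring

theorem hasDerivAt_integral_expTilt {n : ℕ} {ν : Measure (EucSp n)} [IsProbabilityMeasure ν]
    {K : Set (EucSp n)} (hK : IsCompact K) (hν : ν Kᶜ = 0) {g : EucSp n → ℝ} (hg : Continuous g)
    (ξ η : EucSp n) (t : ℝ) :
    HasDerivAt (fun t : ℝ => ∫ x, g x ∂(expTilt ν (ξ + t • η)))
      (∫ x, g x * ⟪x, η⟫ ∂(expTilt ν (ξ + t • η)) -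
        (∫ x, g x ∂(expTilt ν (ξ + t • η))) * ∫ x, ⟪x, η⟫ ∂(expTilt ν (ξ + t • η))) t := by
  obtain ⟨D, hD, hDη⟩ := hasFDerivAt_integral_expTilt hK hν hg (ξ + t • η)
  have h : HasDerivAt (fun t : ℝ => ξ + t • η) η t := by
    simpa using ((hasDerivAt_id t).smul_const η).const_add ξ
  have h2 := hD.comp_hasDerivAt t h
  rw [hDη] at h2
  exact h2

theorem tiltBary_apply {n : ℕ} {ν : Measure (EucSp n)} [IsProbabilityMeasure ν]
    {K : Set (EucSp n)} (hK : IsCompact K) (hν : ν Kᶜ = 0) (ξ η : EucSp n) :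
    ∫ x, ⟪x, η⟫ ∂(expTilt ν ξ) = ⟪tiltBary ν ξ, η⟫ := by
  have := isProbabilityMeasure_expTilt hK hν ξ
  rw [tiltBary, real_inner_comm, ← integral_inner (f := fun x => x)
    (integrable_of_compact_support hK (expTilt_absolutelyContinuous ν ξ hν) continuous_id')]
  simp only [real_inner_comm]

theorem tiltBary_coord {n : ℕ} {ν : Measure (EucSp n)} [IsProbabilityMeasure ν]
    {K : Set (EucSp n)} (hK : IsCompact K) (hν : ν Kᶜ = 0) (ξ : EucSp n) (i : Fin n) :
    ∫ x, x i ∂(expTilt ν ξ) = tiltBary ν ξ i := by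
  simpa [EuclideanSpace.inner_single_right] using
    tiltBary_apply hK hν ξ (EuclideanSpace.single i 1)

theorem tiltCov_mulVec {n : ℕ} {ν : Measure (EucSp n)} [IsProbabilityMeasure ν]
    {K : Set (EucSp n)} (hK : IsCompact K) (hν : ν Kᶜ = 0) (ξ η : EucSp n) (i : Fin n) :
    (tiltCov ν ξ *ᵥ η.ofLp) i = ∫ x, x i * ⟪x, η⟫ ∂(expTilt ν ξ) -
        (∫ x, x i ∂(expTilt ν ξ)) * ∫ x, ⟪x, η⟫ ∂(expTilt ν ξ) := by
  have := isProbabilityMeasure_expTilt hK hν ξ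
  have hInt : ∀ {g : EucSp n → ℝ}, Continuous g → Integrable g (expTilt ν ξ) := fun hg =>
    integrable_of_compact_support hK (expTilt_absolutelyContinuous ν ξ hν) hg
  have e : ∀ x : EucSp n, ⟪x, η⟫ = ∑ j, x j * η j := fun x => by
    simp [PiLp.inner_apply, mul_comm]
  simp only [e, Finset.mul_sum, Matrix.mulVec, dotProduct, tiltCov, Matrix.of_apply]
  rw [integral_finsetSum _ fun j _ => hInt (by fun_prop),
    integral_finsetSum _ fun j _ => hInt (by fun_prop), Finset.mul_sum, ← Finset.sum_sub_distrib]
  refine Finset.sum_congr rfl fun j _ => ?_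
  simp only [← mul_assoc, integral_mul_const]
  ring

/-- The derivative of the barycenter map is the covariance matrix. -/
theorem hasFDerivAt_tiltBary {n : ℕ} {ν : Measure (EucSp n)} [IsProbabilityMeasure ν]
    {K : Set (EucSp n)} (hK : IsCompact K) (hν : ν Kᶜ = 0) (ξ : EucSp n) :
    HasFDerivAt (tiltBary ν) (LinearMap.toContinuousLinearMap
      (Matrix.toLin (EuclideanSpace.basisFun (Fin n) ℝ).toBasis
        (EuclideanSpace.basisFun (Fin n) ℝ).toBasis (tiltCov ν ξ))) ξ := by
  rw [← hasFDerivWithinAt_univ, hasFDerivWithinAt_euclidean]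
  intro i
  rw [hasFDerivWithinAt_univ]
  obtain ⟨D, hD, hDη⟩ := hasFDerivAt_integral_expTilt hK hν (g := fun x => x i) (by fun_prop) ξ
  have e : (fun ξ => ∫ x, x i ∂(expTilt ν ξ)) = fun ξ => tiltBary ν ξ i := by
    ext ξ; exact tiltBary_coord hK hν ξ i
  rw [e] at hD
  refine hD.congr_fderiv ?_
  ext η
  rw [hDη, ← tiltCov_mulVec hK hν]
  simp [Matrix.toLin_apply, Matrix.mulVec, dotProduct]

theorem integral_centered_mul {n : ℕ} {P : Measure (EucSp n)} [IsProbabilityMeasure P]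
    {K : Set (EucSp n)} (hK : IsCompact K) (hP : P Kᶜ = 0) {f g : EucSp n → ℝ}
    (hf : Continuous f) (hg : Continuous g) {a b : ℝ} (ha : ∫ x, f x ∂P = a)
    (hb : ∫ x, g x ∂P = b) :
    ∫ x, (f x - a) * (g x - b) ∂P = ∫ x, f x * g x ∂P - a * b := by
  have hInt : ∀ {u : EucSp n → ℝ}, Continuous u → Integrable u P := fun hu =>
    integrable_of_compact_support hK hP hu
  have e : ∀ x, (f x - a) * (g x - b) = f x * g x - b * f x - (a * g x - a * b) :=
    fun x => by ring
  simp only [e]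
  rw [integral_sub (hInt (by fun_prop)) (hInt (by fun_prop)),
    integral_sub (hInt (by fun_prop)) (hInt (by fun_prop)),
    integral_sub (hInt (by fun_prop)) (hInt (by fun_prop))]
  simp only [integral_const_mul, integral_const, ha, hb, probReal_univ, one_smul]
  ring

theorem integral_centered_mul_mul {n : ℕ} {P : Measure (EucSp n)} [IsProbabilityMeasure P]
    {K : Set (EucSp n)} (hK : IsCompact K) (hP : P Kᶜ = 0) {f g h : EucSp n → ℝ}
    (hf : Continuous f) (hg : Continuous g) (hh : Continuous h) {a b c : ℝ}
    (ha : ∫ x, f x ∂P = a) (hb : ∫ x, g x ∂P = b) (hc : ∫ x, h x ∂P = c) :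
    ∫ x, (f x - a) * (g x - b) * (h x - c) ∂P =
      (∫ x, f x * g x * h x ∂P - (∫ x, f x * g x ∂P) * c) -
        ((∫ x, f x * h x ∂P - a * c) * b + a * (∫ x, g x * h x ∂P - b * c)) := by
  have hInt : ∀ {u : EucSp n → ℝ}, Continuous u → Integrable u P := fun hu =>
    integrable_of_compact_support hK hP hu
  have e : ∀ x, (f x - a) * (g x - b) * (h x - c) =
      (f x * g x * h x - c * (f x * g x)) - (b * (f x * h x) + a * (g x * h x)) +
        ((b * c * f x + a * c * g x) + (a * b * h x - a * b * c)) :=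
    fun x => by ring
  simp only [e]
  rw [integral_add (hInt (by fun_prop)) (hInt (by fun_prop)),
    integral_sub (hInt (by fun_prop)) (hInt (by fun_prop)),
    integral_sub (hInt (by fun_prop)) (hInt (by fun_prop)),
    integral_add (hInt (by fun_prop)) (hInt (by fun_prop)),
    integral_add (hInt (by fun_prop)) (hInt (by fun_prop)),
    integral_add (hInt (by fun_prop)) (hInt (by fun_prop)),
    integral_sub (hInt (by fun_prop)) (hInt (by fun_prop))]
  simp only [integral_const_mul, integral_const, ha, hb, hc, probReal_univ, one_smul]
  ring

theorem tiltCov_apply {n : ℕ} {ν : Measure (EucSp n)} [IsProbabilityMeasure ν]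
    {K : Set (EucSp n)} (hK : IsCompact K) (hν : ν Kᶜ = 0) (ξ : EucSp n) (i j : Fin n) :
    tiltCov ν ξ i j =
      ∫ x, (x - tiltBary ν ξ) i * (x - tiltBary ν ξ) j ∂(expTilt ν ξ) := by
  have := isProbabilityMeasure_expTilt hK hν ξ
  simp only [PiLp.sub_apply]
  rw [integral_centered_mul hK (expTilt_absolutelyContinuous ν ξ hν) (by fun_prop) (by fun_prop)
    (tiltBary_coord hK hν ξ i) (tiltBary_coord hK hν ξ j)]
  simp [tiltCov, tiltBary_coord hK hν]

theorem dotProduct_tiltCov_mulVec {n : ℕ} {ν : Measure (EucSp n)} [IsProbabilityMeasure ν]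
    {K : Set (EucSp n)} (hK : IsCompact K) (hν : ν Kᶜ = 0) (ξ v w : EucSp n) :
    v.ofLp ⬝ᵥ (tiltCov ν ξ *ᵥ w.ofLp) =
      ∫ x, ⟪x - tiltBary ν ξ, v⟫ * ⟪x - tiltBary ν ξ, w⟫ ∂(expTilt ν ξ) := by
  have := isProbabilityMeasure_expTilt hK hν ξ
  have hν' := expTilt_absolutelyContinuous ν ξ hν
  have hInt : ∀ {u : EucSp n → ℝ}, Continuous u → Integrable u (expTilt ν ξ) := fun hu =>
    integrable_of_compact_support hK hν' hu
  simp only [inner_sub_left]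
  rw [integral_centered_mul hK hν' (by fun_prop) (by fun_prop) (tiltBary_apply hK hν ξ v)
    (tiltBary_apply hK hν ξ w)]
  simp only [dotProduct, tiltCov_mulVec hK hν, tiltBary_apply hK hν, tiltBary_coord hK hν]
  have e : ∀ x : EucSp n, ⟪x, v⟫ = ∑ j, v j * x j := fun x => by
    simp [PiLp.inner_apply]
  simp only [e, mul_sub, Finset.sum_sub_distrib, Finset.sum_mul, ← mul_assoc]
  rw [integral_finsetSum _ fun j _ => hInt (by fun_prop)]
  simp only [mul_assoc, integral_const_mul]

theorem hasDerivAt_tiltCov {n : ℕ} {ν : Measure (EucSp n)} [IsProbabilityMeasure ν]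
    {K : Set (EucSp n)} (hK : IsCompact K) (hν : ν Kᶜ = 0) (ξ η : EucSp n) (t : ℝ)
    (i j : Fin n) :
    HasDerivAt (fun t : ℝ => tiltCov ν (ξ + t • η) i j)
      (∫ x, (x - tiltBary ν (ξ + t • η)) i * (x - tiltBary ν (ξ + t • η)) j *
        ⟪x - tiltBary ν (ξ + t • η), η⟫ ∂(expTilt ν (ξ + t • η))) t := by
  have := isProbabilityMeasure_expTilt hK hν (ξ + t • η)
  have hd := fun {g : EucSp n → ℝ} (hg : Continuous g) =>
    hasDerivAt_integral_expTilt hK hν hg ξ η t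
  have h := (hd (g := fun x => x i * x j) (by fun_prop)).sub
    ((hd (g := fun x => x i) (by fun_prop)).mul (hd (g := fun x => x j) (by fun_prop)))
  refine h.congr_deriv ?_
  simp only [PiLp.sub_apply, inner_sub_left]
  rw [integral_centered_mul_mul hK (expTilt_absolutelyContinuous ν _ hν) (by fun_prop)
    (by fun_prop) (by fun_prop) (tiltBary_coord hK hν _ i) (tiltBary_coord hK hν _ j)
    (tiltBary_apply hK hν _ η)]
  simp only [tiltBary_coord hK hν, tiltBary_apply hK hν]

theorem hasDerivAt_inner_tiltBary {n : ℕ} {ν : Measure (EucSp n)} [IsProbabilityMeasure ν]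
    {K : Set (EucSp n)} (hK : IsCompact K) (hν : ν Kᶜ = 0) (ξ η : EucSp n) (t : ℝ) :
    HasDerivAt (fun t : ℝ => ⟪tiltBary ν (ξ + t • η), η⟫)
      (∫ x, ⟪x - tiltBary ν (ξ + t • η), η⟫ ^ 2 ∂(expTilt ν (ξ + t • η))) t := by
  have := isProbabilityMeasure_expTilt hK hν (ξ + t • η)
  have h := hasDerivAt_integral_expTilt hK hν (g := fun x => ⟪x, η⟫) (by fun_prop) ξ η t
  simp only [sq, inner_sub_left]
  rw [integral_centered_mul hK (expTilt_absolutelyContinuous ν _ hν) (by fun_prop)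
    (by fun_prop) (tiltBary_apply hK hν _ η) (tiltBary_apply hK hν _ η)]
  simpa only [tiltBary_apply hK hν] using h

theorem volume_hyperplane_eq_zero {n : ℕ} (b : EucSp n) {v : EucSp n} (hv : v ≠ 0) :
    volume {x : EucSp n | ⟪x - b, v⟫ = 0} = 0 := by
  have h := Measure.addHaar_affineSubspace (volume : Measure (EucSp n))
    (AffineSubspace.mk' b (ℝ ∙ v)ᗮ) (fun h => ?_)
  · refine measure_mono_null (fun x hx => ?_) h
    simpa [AffineSubspace.mem_mk', Submodule.mem_orthogonal_singleton_iff_inner_left] using hx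
  · have : v + b ∈ AffineSubspace.mk' b (ℝ ∙ v)ᗮ := by rw [h]; trivial
    rw [AffineSubspace.mem_mk', Submodule.mem_orthogonal_singleton_iff_inner_left] at this
    simp at this
    exact hv this

theorem integral_inner_sub_sq_pos {n : ℕ} {P : Measure (EucSp n)} [IsProbabilityMeasure P]
    {K : Set (EucSp n)} (hK : IsCompact K) (hP : P Kᶜ = 0) (hac : P ≪ volume) (b : EucSp n)
    {v : EucSp n} (hv : v ≠ 0) : 0 < ∫ x, ⟪x - b, v⟫ ^ 2 ∂P := by
  refine lt_of_le_of_ne (integral_nonneg fun x => sq_nonneg _) fun h => ?_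
  have hc : Continuous fun x : EucSp n => ⟪x - b, v⟫ := by fun_prop
  have h1 := (integral_eq_zero_iff_of_nonneg (fun x => sq_nonneg _)
    (integrable_of_compact_support hK hP (hc.pow 2))).1 h.symm
  have h2 := hac (volume_hyperplane_eq_zero b hv)
  have h3 : ∀ᵐ x ∂P, False := by
    filter_upwards [h1, (measure_eq_zero_iff_ae_notMem.1 h2)] with x hx hx2
    exact hx2 (by simpa using hx)
  simp at h3
  exact IsProbabilityMeasure.ne_zero P h3

theorem tiltCov_posDef {n : ℕ} {ν : Measure (EucSp n)} [IsProbabilityMeasure ν]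
    {K : Set (EucSp n)} (hK : IsCompact K) (hν : ν Kᶜ = 0) (hac : ν ≪ volume) (ξ : EucSp n) :
    (tiltCov ν ξ).PosDef := by
  have := isProbabilityMeasure_expTilt hK hν ξ
  refine Matrix.PosDef.of_dotProduct_mulVec_pos ?_ fun {v} hv => ?_
  · ext i j
    simp [tiltCov, mul_comm]
  · have h := dotProduct_tiltCov_mulVec hK hν ξ (WithLp.toLp 2 v) (WithLp.toLp 2 v)
    simp only [star_trivial]
    rw [h]
    simp only [← sq]
    exact integral_inner_sub_sq_pos hK (expTilt_absolutelyContinuous ν ξ hν)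
      ((expTilt_absolutelyContinuous ν ξ).trans hac) _ (by simpa using hv)

theorem tiltBary_injective {n : ℕ} {ν : Measure (EucSp n)} [IsProbabilityMeasure ν]
    {K : Set (EucSp n)} (hK : IsCompact K) (hν : ν Kᶜ = 0) (hac : ν ≪ volume) :
    Function.Injective (tiltBary ν) := by
  intro ξ ζ h
  by_contra hne
  have hη : ζ - ξ ≠ 0 := sub_ne_zero.2 (Ne.symm hne)
  have hd := hasDerivAt_inner_tiltBary hK hν ξ (ζ - ξ)
  have hm : StrictMono fun t : ℝ => ⟪tiltBary ν (ξ + t • (ζ - ξ)), ζ - ξ⟫ := by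
    refine strictMono_of_deriv_pos fun t => ?_
    have := isProbabilityMeasure_expTilt hK hν (ξ + t • (ζ - ξ))
    rw [(hd t).deriv]
    exact integral_inner_sub_sq_pos hK (expTilt_absolutelyContinuous ν _ hν)
      ((expTilt_absolutelyContinuous ν _).trans hac) _ hη
  have := hm (zero_lt_one)
  simp [h] at this

theorem hasDerivAt_det {n : ℕ} {A : ℝ → Matrix (Fin n) (Fin n) ℝ} {A' : Matrix (Fin n) (Fin n) ℝ}
    {t : ℝ} (hA : ∀ i j, HasDerivAt (fun s => A s i j) (A' i j) t) :
    HasDerivAt (fun s => (A s).det) ((A t).adjugate * A').trace t := by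
  have h : HasDerivAt (fun s => ∑ σ : Equiv.Perm (Fin n),
      ((Equiv.Perm.sign σ : ℤ) : ℝ) * ∏ i, A s (σ i) i)
      (∑ σ : Equiv.Perm (Fin n), ((Equiv.Perm.sign σ : ℤ) : ℝ) *
        ∑ i, (∏ j ∈ Finset.univ.erase i, A t (σ j) j) • A' (σ i) i) t :=
    HasDerivAt.fun_sum fun σ _ =>
      (HasDerivAt.fun_finsetProd fun i _ => hA (σ i) i).const_mul _
  have e : ((A t).adjugate * A').trace = ∑ σ : Equiv.Perm (Fin n),
      ((Equiv.Perm.sign σ : ℤ) : ℝ) *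
        ∑ i, (∏ j ∈ Finset.univ.erase i, A t (σ j) j) • A' (σ i) i := by
    simp only [Finset.mul_sum]
    rw [Finset.sum_comm, Matrix.trace]
    refine Finset.sum_congr rfl fun i _ => ?_
    have h1 : ((A t).adjugate * A').diag i = ((A t).updateCol i (fun k => A' k i)).det := by
      rw [← Matrix.cramer_apply, Matrix.cramer_eq_adjugate_mulVec]
      rfl
    rw [h1, Matrix.det_apply']
    refine Finset.sum_congr rfl fun σ _ => ?_
    rw [← Finset.mul_prod_erase _ _ (Finset.mem_univ i), smul_eq_mul, mul_comm (Finset.prod _ _) (A' _ _)]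
    congr 2
    · simp
    · refine Finset.prod_congr rfl fun j hj => ?_
      rw [Matrix.updateCol_ne (Finset.ne_of_mem_erase hj)]
  rw [e]
  simpa only [Matrix.det_apply'] using h

theorem pow_le_det {n : ℕ} {Q : Matrix (Fin n) (Fin n) ℝ} (hQ : Q.IsHermitian) {a : ℝ}
    (ha : 0 ≤ a) (h : ∀ v : EucSp n, a * ‖v‖ ^ 2 ≤ v.ofLp ⬝ᵥ (Q *ᵥ v.ofLp)) :
    a ^ n ≤ Q.det := by
  rw [hQ.det_eq_prod_eigenvalues]
  have h1 : ∀ i, a ≤ hQ.eigenvalues i := fun i => by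
    have := h (hQ.eigenvectorBasis i)
    rw [hQ.eigenvalues_eq]
    simpa using this
  calc a ^ n = ∏ _i : Fin n, a := by simp
    _ ≤ _ := Finset.prod_le_prod (fun _ _ => ha) fun i _ => by simpa using h1 i

theorem exists_mul_transpose_eq {n : ℕ} {Q : Matrix (Fin n) (Fin n) ℝ} (hQ : Q.PosDef) :
    ∃ S T : Matrix (Fin n) (Fin n) ℝ, T * S = 1 ∧ Q = S * Sᵀ ∧ Q⁻¹ = Tᵀ * T := by
  open scoped MatrixOrder in
  obtain ⟨B, hB⟩ := CStarAlgebra.nonneg_iff_eq_star_mul_self.mp hQ.posSemidef.nonneg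
  have hB' : Q = Bᵀ * B := by
    rw [hB, Matrix.star_eq_conjTranspose, Matrix.conjTranspose_eq_transpose_of_trivial]
  have hdet : IsUnit B.det := by
    have := hQ.det_pos
    rw [hB', Matrix.det_mul, Matrix.det_transpose] at this
    exact isUnit_iff_ne_zero.2 fun h => by simp [h] at this
  refine ⟨Bᵀ, (Bᵀ)⁻¹, Matrix.nonsing_inv_mul _ (by simpa using hdet), by simpa using hB', ?_⟩
  rw [hB', Matrix.mul_inv_rev, Matrix.transpose_nonsing_inv, Matrix.transpose_transpose]

theorem IsLogConcave.map_affine {n : ℕ} {μ : Measure (EucSp n)} (hμ : IsLogConcave μ)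
    (L : EucSp n ≃L[ℝ] EucSp n) (b : EucSp n) :
    IsLogConcave (μ.map fun x => L (x - b)) := by
  obtain ⟨f, ⟨hf0, hf⟩, rfl⟩ := hμ
  set c : ℝ := |(LinearMap.det (L : EucSp n →ₗ[ℝ] EucSp n))⁻¹|
  have hdet : LinearMap.det (L : EucSp n →ₗ[ℝ] EucSp n) ≠ 0 :=
    (LinearEquiv.isUnit_det' L.toLinearEquiv).ne_zero
  have hc : 0 < c := abs_pos.2 (inv_ne_zero hdet)
  have hvol : (volume : Measure (EucSp n)).map (fun x => L (x - b)) =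
      ENNReal.ofReal c • volume := by
    have h1 : (fun x => L (x - b)) = L ∘ fun x => x - b := rfl
    rw [h1, ← Measure.map_map L.continuous.measurable (by fun_prop),
      (measurePreserving_sub_right volume b).map_eq]
    exact Measure.map_linearMap_addHaar_eq_smul_addHaar volume hdet
  let e : EucSp n ≃ᵐ EucSp n :=
    ((Homeomorph.subRight b).trans L.toHomeomorph).toMeasurableEquiv
  have he : ⇑e = fun x => L (x - b) := rfl
  refine ⟨fun z => c * f (L.symm z + b), (isLogConcaveFn_const hc).mul ⟨fun z => hf0 _, ?_⟩, ?_⟩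
  · intro x y l hl
    convert hf (L.symm x + b) (L.symm y + b) l hl using 2
    have e : (1 - l) • b + l • b = b := by rw [← add_smul]; simp
    simp only [map_add, map_smul, smul_add]
    rw [add_add_add_comm, e]
  · rw [← he] at hvol ⊢
    ext s hs
    rw [e.map_apply, withDensity_apply _ (e.measurable hs), withDensity_apply _ hs]
    have h2 : ∀ z, ENNReal.ofReal (c * f (L.symm z + b)) =
        ENNReal.ofReal c * ENNReal.ofReal (f (L.symm z + b)) := fun z =>
      ENNReal.ofReal_mul hc.le
    simp only [h2]
    rw [lintegral_const_mul' _ _ ENNReal.ofReal_ne_top, ← smul_eq_mul, ← lintegral_smul_measure,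
      ← Measure.restrict_smul, ← hvol, e.measurableEmbedding.restrict_map,
      e.measurableEmbedding.lintegral_map]
    refine lintegral_congr fun x => ?_
    simp [he]

theorem isLogConcave_expTilt {n : ℕ} {ν : Measure (EucSp n)} [IsProbabilityMeasure ν]
    (hν : IsLogConcave ν) {K : Set (EucSp n)} (hK : IsCompact K) (hνK : ν Kᶜ = 0)
    (ξ : EucSp n) : IsLogConcave (expTilt ν ξ) := by
  have hZ : 0 < ∫ x, Real.exp ⟪ξ, x⟫ ∂ν :=
    integral_exp_pos (integrable_of_compact_support hK hνK (by fun_prop))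
  have e : expTilt ν ξ = ν.withDensity fun x => ENNReal.ofReal
      ((∫ x, Real.exp ⟪ξ, x⟫ ∂ν)⁻¹ * Real.exp ⟪ξ, x⟫) := by
    simp only [expTilt, Measure.tilted, div_eq_inv_mul]
  rw [e]
  exact hν.withDensity ((isLogConcaveFn_const (inv_pos.2 hZ)).mul (isLogConcaveFn_exp_inner ξ))
    (by fun_prop)

theorem abs_integral_norm_sq_mul_inner_le {n : ℕ} {P : Measure (EucSp n)}
    [IsProbabilityMeasure P] (hP : IsLogConcave P) {K : Set (EucSp n)} (hK : IsCompact K)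
    (hPK : P Kᶜ = 0) {b : EucSp n} (hb : ∫ x, x ∂P = b) {S T : Matrix (Fin n) (Fin n) ℝ}
    (hTS : T * S = 1)
    (hQ : ∀ v w : EucSp n, ∫ x, ⟪x - b, v⟫ * ⟪x - b, w⟫ ∂P = v.ofLp ⬝ᵥ ((S * Sᵀ) *ᵥ w.ofLp))
    {M : ℝ} (hM : ∀ ρ : Measure (EucSp n), IsProbabilityMeasure ρ → IsIsotropic ρ →
      IsLogConcave ρ → ‖∫ x, (‖x‖ ^ 2) • x ∂ρ‖ ≤ M) (ξ : EucSp n) :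
    |∫ x, ‖T.toEuclideanLin (x - b)‖ ^ 2 * ⟪x - b, ξ⟫ ∂P| ≤
      M * ‖Sᵀ.toEuclideanLin ξ‖ := by
  have hST : S * T = 1 := mul_eq_one_comm.1 hTS
  have hInt : ∀ {F : Type} [NormedAddCommGroup F] {u : EucSp n → F}, Continuous u →
      Integrable u P := fun hu => integrable_of_compact_support hK hPK hu
  have adj : ∀ (A : Matrix (Fin n) (Fin n) ℝ) (x y : EucSp n),
      ⟪A.toEuclideanLin x, y⟫ = ⟪x, Aᵀ.toEuclideanLin y⟫ := fun A x y => by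
    simp only [EuclideanSpace.inner_eq_star_dotProduct, Matrix.toLpLin_apply, star_trivial]
    rw [Matrix.dotProduct_mulVec, ← Matrix.mulVec_transpose]
  have comp : ∀ (A B : Matrix (Fin n) (Fin n) ℝ) (x : EucSp n),
      A.toEuclideanLin (B.toEuclideanLin x) = (A * B).toEuclideanLin x := fun A B x => by
    simp [Matrix.toLpLin_apply, Matrix.mulVec_mulVec]
  have one : ∀ x : EucSp n, (1 : Matrix (Fin n) (Fin n) ℝ).toEuclideanLin x = x := fun x => by
    simp
  let L : EucSp n ≃L[ℝ] EucSp n := (LinearEquiv.ofLinearMap T.toEuclideanLin S.toEuclideanLin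
    (LinearMap.ext fun x => by simp only [LinearMap.comp_apply, comp, hTS, one]; rfl)
    (LinearMap.ext fun x => by
      simp only [LinearMap.comp_apply, comp, hST, one]; rfl)).toContinuousLinearEquiv
  have hL : ∀ x, L x = T.toEuclideanLin x := fun x => rfl
  have hmeas : Measurable fun x => L (x - b) := by fun_prop
  set ρ := P.map fun x => L (x - b) with hρ
  have hρP : IsProbabilityMeasure ρ := Measure.isProbabilityMeasure_map hmeas.aemeasurable
  have hiso : IsIsotropic ρ := by
    constructor
    · rw [hρ, integral_map hmeas.aemeasurable (by fun_prop)]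
      rw [L.integral_comp_comm (fun x => x - b), integral_sub (hInt continuous_id')
        (hInt continuous_const), hb]
      simp
    · intro u v
      rw [hρ, integral_map hmeas.aemeasurable (Continuous.aestronglyMeasurable (by fun_prop))]
      simp only [hL, adj]
      rw [hQ]
      have e : (S * Sᵀ) *ᵥ (Tᵀ.toEuclideanLin v).ofLp = S *ᵥ v.ofLp := by
        rw [Matrix.toLpLin_apply, Matrix.mulVec_mulVec, Matrix.mul_assoc,
          ← Matrix.transpose_mul, hTS, Matrix.transpose_one, Matrix.mul_one]
      rw [e, Matrix.toLpLin_apply, Matrix.mulVec_transpose, ← Matrix.dotProduct_mulVec,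
        Matrix.mulVec_mulVec, hTS, Matrix.one_mulVec]
      simp [EuclideanSpace.inner_eq_star_dotProduct, dotProduct_comm]
  have h := hM ρ hρP hiso (hP.map_affine L b)
  have e : ∫ x, ‖T.toEuclideanLin (x - b)‖ ^ 2 * ⟪x - b, ξ⟫ ∂P =
      ⟪Sᵀ.toEuclideanLin ξ, ∫ x, (‖x‖ ^ 2) • x ∂ρ⟫ := by
    have hc : Continuous fun x : EucSp n => (‖x‖ ^ 2) • x := by fun_prop
    rw [hρ, integral_map hmeas.aemeasurable hc.aestronglyMeasurable,
      ← integral_inner (hInt (by fun_prop))]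
    refine integral_congr_ae (ae_of_all _ fun x => ?_)
    simp only [hL, inner_smul_right]
    rw [adj, Matrix.transpose_transpose, comp, hST, one, real_inner_comm]
  rw [e]
  calc _ ≤ ‖Sᵀ.toEuclideanLin ξ‖ * ‖∫ x, (‖x‖ ^ 2) • x ∂ρ‖ := abs_real_inner_le_norm _ _
    _ ≤ ‖Sᵀ.toEuclideanLin ξ‖ * M := by gcongr
    _ = _ := mul_comm _ _

/-- Along rays the logarithm of the determinant of the covariance of the tilts
cannot decrease too fast. -/
theorem log_det_tiltCov_ge {n : ℕ} {ν : Measure (EucSp n)} [IsProbabilityMeasure ν]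
    (hν : IsLogConcave ν) {K : Set (EucSp n)} (hK : IsCompact K) (hνK : ν Kᶜ = 0) {σ : ℝ}
    (hσ : ∀ ρ : Measure (EucSp n), IsProbabilityMeasure ρ → IsIsotropic ρ →
      IsLogConcave ρ → ‖∫ x, (‖x‖ ^ 2) • x ∂ρ‖ ≤ √n * σ) (hb0 : tiltBary ν 0 = 0)
    (ξ : EucSp n) :
    Real.log (tiltCov ν 0).det - (n + σ ^ 2 * ⟪tiltBary ν ξ, ξ⟫) / 2 ≤
      Real.log (tiltCov ν ξ).det := by
  have hac : ν ≪ volume := by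
    obtain ⟨f, -, rfl⟩ := hν
    exact withDensity_absolutelyContinuous _ _
  set ψ : ℝ → ℝ := fun t => Real.log (tiltCov ν (0 + t • ξ)).det +
    (n * t + σ ^ 2 * ⟪tiltBary ν (0 + t • ξ), ξ⟫) / 2 with hψ
  have hderiv : ∀ t, ∃ d, HasDerivAt ψ d t ∧ 0 ≤ d := by
    intro t
    set ζ := 0 + t • ξ with hζ
    set b := tiltBary ν ζ with hb
    set P := expTilt ν ζ with hP
    have hPprob : IsProbabilityMeasure P := isProbabilityMeasure_expTilt hK hνK ζ
    have hPK : P Kᶜ = 0 := expTilt_absolutelyContinuous ν ζ hνK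
    have hQ := tiltCov_posDef hK hνK hac ζ
    obtain ⟨S, T, hTS, hS, hT⟩ := exists_mul_transpose_eq hQ
    have hd := ((hasDerivAt_det (hasDerivAt_tiltCov hK hνK 0 ξ t)).log hQ.det_pos.ne').add
      ((((hasDerivAt_id t).const_mul (n : ℝ)).add
        ((hasDerivAt_inner_tiltBary hK hνK 0 ξ t).const_mul (σ ^ 2))).div_const 2)
    refine ⟨_, hd, ?_⟩
    have hbil : ∀ v w : EucSp n, ∫ x, ⟪x - b, v⟫ * ⟪x - b, w⟫ ∂P =
        v.ofLp ⬝ᵥ ((S * Sᵀ) *ᵥ w.ofLp) := fun v w => by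
      rw [← dotProduct_tiltCov_mulVec hK hνK ζ v w, hS]
    have hthird := abs_integral_norm_sq_mul_inner_le (isLogConcave_expTilt hν hK hνK ζ) hK hPK
      (b := b) rfl hTS hbil hσ ξ
    have hnorm : ‖Sᵀ.toEuclideanLin ξ‖ ^ 2 = ∫ x, ⟪x - b, ξ⟫ ^ 2 ∂P := by
      simp only [sq, hbil]
      rw [← real_inner_self_eq_norm_mul_norm]
      simp only [EuclideanSpace.inner_eq_star_dotProduct, Matrix.toLpLin_apply, star_trivial]
      rw [← Matrix.mulVec_mulVec, Matrix.dotProduct_mulVec ξ.ofLp, ← Matrix.mulVec_transpose]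
    have htrace : ((tiltCov ν ζ).adjugate * Matrix.of fun i j =>
        ∫ x, (x - b) i * (x - b) j * ⟪x - b, ξ⟫ ∂P).trace / (tiltCov ν ζ).det =
        ∫ x, ‖T.toEuclideanLin (x - b)‖ ^ 2 * ⟪x - b, ξ⟫ ∂P := by
      have hInt : ∀ {u : EucSp n → ℝ}, Continuous u → Integrable u P := fun hu =>
        integrable_of_compact_support hK hPK hu
      have h1 : ∀ M : Matrix (Fin n) (Fin n) ℝ,
          ((tiltCov ν ζ).adjugate * M).trace / (tiltCov ν ζ).det = ((Tᵀ * T) * M).trace := by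
        intro M
        rw [← hT, Matrix.inv_def, Ring.inverse_eq_inv', Matrix.smul_mul, Matrix.trace_smul,
          smul_eq_mul, div_eq_inv_mul]
      have h2 : ∀ y : EucSp n, ‖T.toEuclideanLin y‖ ^ 2 = ∑ i, ∑ j, (Tᵀ * T) i j * (y j * y i) := by
        intro y
        have : ‖T.toEuclideanLin y‖ ^ 2 = y.ofLp ⬝ᵥ ((Tᵀ * T) *ᵥ y.ofLp) := by
          rw [sq, ← real_inner_self_eq_norm_mul_norm]
          simp only [EuclideanSpace.inner_eq_star_dotProduct, Matrix.toLpLin_apply, star_trivial]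
          rw [← Matrix.mulVec_mulVec, Matrix.dotProduct_mulVec y.ofLp, Matrix.vecMul_transpose]
        rw [this]
        simp only [dotProduct, Matrix.mulVec, Finset.mul_sum]
        exact Finset.sum_congr rfl fun i _ => Finset.sum_congr rfl fun j _ => by ring
      rw [h1]
      simp only [h2, Finset.sum_mul]
      rw [integral_finsetSum _ fun i _ => hInt (by fun_prop)]
      refine Finset.sum_congr rfl fun i _ => ?_
      rw [integral_finsetSum _ fun j _ => hInt (by fun_prop), Matrix.diag_apply, Matrix.mul_apply]
      refine Finset.sum_congr rfl fun j _ => ?_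
      rw [Matrix.of_apply, ← integral_const_mul]
      simp only [mul_assoc]
    have hsum : 0 ≤ ((tiltCov ν ζ).adjugate * Matrix.of fun i j =>
        ∫ x, (x - b) i * (x - b) j * ⟪x - b, ξ⟫ ∂P).trace / (tiltCov ν ζ).det +
        ((n : ℝ) * 1 + σ ^ 2 * ∫ x, ⟪x - b, ξ⟫ ^ 2 ∂P) / 2 := by
      rw [htrace, ← hnorm]
      have h1 := (abs_le.1 hthird).1
      have h2 := sq_nonneg (√n - σ * ‖Sᵀ.toEuclideanLin ξ‖)
      have h3 := Real.sq_sqrt (Nat.cast_nonneg (α := ℝ) n)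
      nlinarith
    exact hsum
  have hmono : Monotone ψ := by
    refine monotone_of_deriv_nonneg (fun t => ?_) fun t => ?_
    · obtain ⟨d, hd, -⟩ := hderiv t
      exact hd.differentiableAt
    · obtain ⟨d, hd, h0⟩ := hderiv t
      rwa [hd.deriv]
  have := hmono (zero_le_one' ℝ)
  simp only [hψ, zero_smul, one_smul, zero_add, hb0, inner_zero_left, mul_zero, mul_one,
    add_zero, zero_div] at this
  linarith

/-- The cube `[-s, s]ⁿ`. -/
def cube (n : ℕ) (s : ℝ) : Set (EucSp n) :=
  WithLp.ofLp ⁻¹' Set.Icc (fun _ : Fin n => -s) (fun _ => s)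

theorem measurableSet_cube (n : ℕ) (s : ℝ) : MeasurableSet (cube n s) :=
  measurableSet_Icc.preimage (by fun_prop)

theorem volume_cube (n : ℕ) {s : ℝ} (hs : 0 ≤ s) :
    volume (cube n s) = ENNReal.ofReal ((2 * s) ^ n) := by
  rw [cube, (PiLp.volume_preserving_ofLp (Fin n)).measure_preimage
    measurableSet_Icc.nullMeasurableSet, Real.volume_Icc_pi,
    ENNReal.ofReal_pow (by linarith)]
  simp [two_mul]

theorem setIntegral_Icc_exp_le {s : ℝ} (hs : 0 ≤ s) (y : ℝ) :
    ∫ u in Set.Icc (-s) s, Real.exp (2 * (u * y)) ≤ 2 * s * Real.exp (2 * s ^ 2 * y ^ 2) := by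
  have hss : -s ≤ s := by linarith
  rw [integral_Icc_eq_integral_Ioc, ← intervalIntegral.integral_of_le hss]
  have hi : ∀ {g : ℝ → ℝ}, Continuous g → IntervalIntegrable g volume (-s) s := fun hg =>
    hg.intervalIntegrable _ _
  have h1 : ∫ u in (-s)..s, Real.exp (2 * (u * y)) =
      ∫ u in (-s)..s, Real.exp (-(2 * (u * y))) := by
    have := intervalIntegral.integral_comp_neg (a := -s) (b := s)
      fun u => Real.exp (2 * (u * y))
    rw [neg_neg] at this
    rw [← this]
    simp only [neg_mul, mul_neg]
  have h2 : ∫ u in (-s)..s, Real.exp (2 * (u * y)) = ∫ u in (-s)..s, Real.cosh (2 * (u * y)) := by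
    simp only [Real.cosh_eq]
    rw [intervalIntegral.integral_div, intervalIntegral.integral_add (hi (by fun_prop))
      (hi (by fun_prop)), ← h1]
    ring
  rw [h2]
  calc _ ≤ ∫ _u in (-s)..s, Real.exp (2 * s ^ 2 * y ^ 2) := by
        refine intervalIntegral.integral_mono_on hss (hi (by fun_prop)) (hi (by fun_prop))
          fun u hu => (Real.cosh_le_exp_half_sq _).trans (Real.exp_le_exp.2 ?_)
        have : u ^ 2 ≤ s ^ 2 := sq_le_sq' hu.1 hu.2
        nlinarith [mul_le_mul_of_nonneg_right this (sq_nonneg y)]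
    _ = _ := by
        rw [intervalIntegral.integral_const, smul_eq_mul]; ring

theorem setLIntegral_cube_exp_le {n : ℕ} {s : ℝ} (hs : 0 ≤ s) (x : EucSp n) :
    ∫⁻ ξ in cube n s, ENNReal.ofReal (Real.exp (2 * ⟪ξ, x⟫)) ≤
      ENNReal.ofReal ((2 * s) ^ n * Real.exp (2 * s ^ 2 * ‖x‖ ^ 2)) := by
  have e : ∀ ξ : EucSp n, Real.exp (2 * ⟪ξ, x⟫) =
      ∏ i, Real.exp (2 * (ξ.ofLp i * x i)) := fun ξ => by
    rw [← Real.exp_sum, ← Finset.mul_sum]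
    simp [PiLp.inner_apply, mul_comm]
  simp only [e]
  have hc : Continuous fun y : Fin n → ℝ => ∏ i, Real.exp (2 * (y i * x i)) := by fun_prop
  rw [cube, (PiLp.volume_preserving_ofLp (Fin n)).setLIntegral_comp_preimage measurableSet_Icc
    (f := fun y => ENNReal.ofReal (∏ i, Real.exp (2 * (y i * x i)))) (by fun_prop),
    ← ofReal_integral_eq_lintegral_ofReal (hc.continuousOn.integrableOn_compact isCompact_Icc)
      (ae_of_all _ fun y => by positivity)]
  refine ENNReal.ofReal_le_ofReal ?_
  rw [← Set.pi_univ_Icc, volume_pi, Measure.restrict_pi_pi,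
    integral_fintype_prod_eq_prod (fun i u => Real.exp (2 * (u * x i)))]
  calc _ ≤ ∏ i : Fin n, (2 * s * Real.exp (2 * s ^ 2 * x i ^ 2)) :=
        Finset.prod_le_prod (fun i _ => integral_nonneg fun u => (Real.exp_pos _).le)
          fun i _ => setIntegral_Icc_exp_le hs (x i)
    _ = _ := by
        rw [Finset.prod_mul_distrib, ← Real.exp_sum, ← Finset.mul_sum, EuclideanSpace.norm_sq_eq]
        simp

theorem setLIntegral_cube_laplace_le {n : ℕ} {ν : Measure (EucSp n)} [IsProbabilityMeasure ν]
    {s r : ℝ} (hs : 0 ≤ s) (hν : ν (Metric.closedBall 0 r)ᶜ = 0) :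
    ∫⁻ ξ in cube n s, ENNReal.ofReal (∫ x, Real.exp (2 * ⟪ξ, x⟫) ∂ν) ≤
      ENNReal.ofReal ((2 * s) ^ n * Real.exp (2 * s ^ 2 * r ^ 2)) := by
  have h1 : ∀ ξ : EucSp n, ENNReal.ofReal (∫ x, Real.exp (2 * ⟪ξ, x⟫) ∂ν) =
      ∫⁻ x, ENNReal.ofReal (Real.exp (2 * ⟪ξ, x⟫)) ∂ν := fun ξ =>
    ofReal_integral_eq_lintegral_ofReal
      (integrable_of_compact_support (isCompact_closedBall 0 r) hν (by fun_prop))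
      (ae_of_all _ fun x => (Real.exp_pos _).le)
  simp only [h1]
  rw [lintegral_lintegral_swap (by fun_prop)]
  calc _ ≤ ∫⁻ _x, ENNReal.ofReal ((2 * s) ^ n * Real.exp (2 * s ^ 2 * r ^ 2)) ∂ν := by
        refine lintegral_mono_ae ?_
        filter_upwards [measure_eq_zero_iff_ae_notMem.1 hν] with x hx
        have hx' : ‖x‖ ≤ r := by simpa using hx
        refine (setLIntegral_cube_exp_le hs x).trans (ENNReal.ofReal_le_ofReal ?_)
        gcongr
    _ = _ := by simp

theorem inner_tiltBary_nonneg {n : ℕ} {ν : Measure (EucSp n)} [IsProbabilityMeasure ν]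
    {K : Set (EucSp n)} (hK : IsCompact K) (hν : ν Kᶜ = 0) (hb0 : tiltBary ν 0 = 0)
    (ξ : EucSp n) : 0 ≤ ⟪tiltBary ν ξ, ξ⟫ := by
  have hd := hasDerivAt_inner_tiltBary hK hν 0 ξ
  have hm : Monotone fun t : ℝ => ⟪tiltBary ν (0 + t • ξ), ξ⟫ :=
    monotone_of_deriv_nonneg (fun t => (hd t).differentiableAt) fun t => by
      rw [(hd t).deriv]
      exact integral_nonneg fun x => sq_nonneg _
  simpa [hb0] using hm (zero_le_one' ℝ)

theorem exp_inner_tiltBary_le {n : ℕ} {ν : Measure (EucSp n)} [IsProbabilityMeasure ν]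
    {K : Set (EucSp n)} (hK : IsCompact K) (hν : ν Kᶜ = 0) (hb0 : tiltBary ν 0 = 0)
    (ξ : EucSp n) : Real.exp ⟪tiltBary ν ξ, ξ⟫ ≤ ∫ x, Real.exp (2 * ⟪ξ, x⟫) ∂ν := by
  have hP := isProbabilityMeasure_expTilt hK hν ξ
  have hInt : ∀ {P : Measure (EucSp n)} [IsFiniteMeasure P], P ≪ ν →
      ∀ {u : EucSp n → ℝ}, Continuous u → Integrable u P := fun hac _ hu =>
    integrable_of_compact_support hK (hac hν) hu
  have hac := expTilt_absolutelyContinuous ν ξ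
  have jensen : ∀ (P : Measure (EucSp n)) [IsProbabilityMeasure P], P ≪ ν →
      Real.exp (∫ x, ⟪ξ, x⟫ ∂P) ≤ ∫ x, Real.exp ⟪ξ, x⟫ ∂P := by
    intro P _ hP
    set m := ∫ x, ⟪ξ, x⟫ ∂P
    calc Real.exp m = ∫ x, Real.exp m * (⟪ξ, x⟫ - m + 1) ∂P := by
          rw [integral_const_mul, integral_add (hInt hP (by fun_prop)) (hInt hP (by fun_prop)),
            integral_sub (hInt hP (by fun_prop)) (hInt hP (by fun_prop))]
          simp [m]
      _ ≤ _ := by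
          refine integral_mono (hInt hP (by fun_prop)) (hInt hP (by fun_prop)) fun x => ?_
          calc Real.exp m * (⟪ξ, x⟫ - m + 1) ≤ Real.exp m * Real.exp (⟪ξ, x⟫ - m) := by
                gcongr; exact Real.add_one_le_exp _
            _ = _ := by rw [← Real.exp_add]; congr 1; ring
  have h1 := jensen _ hac
  have h0 := jensen ν (Measure.AbsolutelyContinuous.refl ν)
  have e0 : ∫ x, ⟪ξ, x⟫ ∂ν = 0 := by
    have := tiltBary_apply hK hν 0 ξ
    rw [expTilt_zero, hb0, inner_zero_left] at this
    simpa only [real_inner_comm] using this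
  have e1 : ∫ x, ⟪ξ, x⟫ ∂(expTilt ν ξ) = ⟪tiltBary ν ξ, ξ⟫ := by
    rw [← tiltBary_apply hK hν ξ ξ]
    simp only [real_inner_comm]
  rw [e0, Real.exp_zero] at h0
  rw [e1, integral_expTilt] at h1
  simp only [← Real.exp_add, ← two_mul, mul_one] at h1
  exact h1.trans (div_le_self (integral_nonneg fun x => (Real.exp_pos _).le) h0)

/-- The barycenters of at least half of the tilts in a cube satisfy a bound. -/
theorem half_cube_le {n : ℕ} {ν : Measure (EucSp n)} [IsProbabilityMeasure ν]
    {s r : ℝ} (hs : 0 ≤ s) (hν : ν (Metric.closedBall 0 r)ᶜ = 0) (hb0 : tiltBary ν 0 = 0)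
    {a : ℝ} (ha : 0 < a) (har : a = 2 * (2 * s ^ 2 * r ^ 2)) :
    ENNReal.ofReal ((2 * s) ^ n / 2) ≤
      volume (cube n s ∩ {ξ | ⟪tiltBary ν ξ, ξ⟫ ≤ a}) := by
  set L := 2 * s ^ 2 * r ^ 2 with hL
  have hK := isCompact_closedBall (0 : EucSp n) r
  have hbc : Continuous (tiltBary ν) := continuous_iff_continuousAt.2 fun ξ =>
    (hasFDerivAt_tiltBary hK hν ξ).continuousAt
  set V := ENNReal.ofReal ((2 * s) ^ n) with hV
  have hVtop : V ≠ ⊤ := ENNReal.ofReal_ne_top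
  have hvol := volume_cube n hs
  set u : EucSp n → ℝ := fun ξ => ⟪tiltBary ν ξ, ξ⟫ with hu
  have huc : Continuous u := by fun_prop
  have hpt : ∀ ξ, ENNReal.ofReal (u ξ) + 1 ≤ ENNReal.ofReal L +
      ENNReal.ofReal (Real.exp (-L)) * ENNReal.ofReal (∫ x, Real.exp (2 * ⟪ξ, x⟫) ∂ν) := by
    intro ξ
    have h1 := exp_inner_tiltBary_le hK hν hb0 ξ
    have h2 := inner_tiltBary_nonneg hK hν hb0 ξ
    have hL0 : 0 ≤ L := by positivity
    have h3 : 0 ≤ ∫ x, Real.exp (2 * ⟪ξ, x⟫) ∂ν := integral_nonneg fun x => (Real.exp_pos _).le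
    rw [← ENNReal.ofReal_one, ← ENNReal.ofReal_add h2 zero_le_one,
      ← ENNReal.ofReal_mul (Real.exp_pos _).le, ← ENNReal.ofReal_add hL0 (by positivity)]
    refine ENNReal.ofReal_le_ofReal ?_
    have h4 := Real.add_one_le_exp (-L + u ξ)
    rw [Real.exp_add] at h4
    have h5 := mul_le_mul_of_nonneg_left h1 (Real.exp_pos (-L)).le
    simp only [hu] at h4 h5 ⊢
    linarith
  have hInt : ∫⁻ ξ in cube n s, ENNReal.ofReal (u ξ) ≤ ENNReal.ofReal L * V := by
    have h1 : ∫⁻ ξ in cube n s, (ENNReal.ofReal (u ξ) + 1) ≤ ENNReal.ofReal L * V + V := by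
      refine (lintegral_mono hpt).trans ?_
      rw [lintegral_add_left measurable_const, lintegral_const_mul' _ _ ENNReal.ofReal_ne_top,
        setLIntegral_const, hvol]
      gcongr
      refine (mul_le_mul_right (setLIntegral_cube_laplace_le hs hν) _).trans ?_
      rw [← ENNReal.ofReal_mul (Real.exp_pos _).le, mul_left_comm, ← Real.exp_add]
      simp [hV, hL]
    rw [lintegral_add_right _ measurable_const, setLIntegral_const, hvol, one_mul] at h1
    exact (ENNReal.add_le_add_iff_right hVtop).1 h1
  have hmarkov : volume (cube n s ∩ {ξ | a < u ξ}) ≤ ENNReal.ofReal ((2 * s) ^ n / 2) := by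
    have h1 := mul_meas_ge_le_lintegral (μ := volume.restrict (cube n s))
      (f := fun ξ => ENNReal.ofReal (u ξ)) (by fun_prop) (ENNReal.ofReal a)
    have h2 : volume (cube n s ∩ {ξ | a < u ξ}) ≤
        volume.restrict (cube n s) {ξ | ENNReal.ofReal a ≤ ENNReal.ofReal (u ξ)} := by
      rw [Measure.restrict_apply (measurableSet_le measurable_const (by fun_prop)),
        Set.inter_comm]
      exact measure_mono (Set.inter_subset_inter_left _ fun ξ hξ =>
        ENNReal.ofReal_le_ofReal (le_of_lt hξ))
    have h3 : ENNReal.ofReal a * volume (cube n s ∩ {ξ | a < u ξ}) ≤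
        ENNReal.ofReal a * ENNReal.ofReal ((2 * s) ^ n / 2) := by
      refine ((mul_le_mul_right h2 _).trans (h1.trans hInt)).trans (le_of_eq ?_)
      rw [hV, ← ENNReal.ofReal_mul (by positivity), ← ENNReal.ofReal_mul ha.le, har]
      congr 1; ring
    exact (ENNReal.mul_le_mul_iff_right (by simpa using ha) ENNReal.ofReal_ne_top).1 h3
  have hsplit : V ≤ volume (cube n s ∩ {ξ | u ξ ≤ a}) + ENNReal.ofReal ((2 * s) ^ n / 2) := by
    rw [hV, ← hvol]
    calc volume (cube n s) ≤ volume ((cube n s ∩ {ξ | u ξ ≤ a}) ∪ (cube n s ∩ {ξ | a < u ξ})) :=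
          measure_mono fun ξ hξ => (le_or_gt (u ξ) a).imp (fun h => ⟨hξ, h⟩) fun h => ⟨hξ, h⟩
      _ ≤ _ := (measure_union_le _ _).trans (by gcongr)
  have hhalf : V = ENNReal.ofReal ((2 * s) ^ n / 2) + ENNReal.ofReal ((2 * s) ^ n / 2) := by
    rw [← ENNReal.ofReal_add (by positivity) (by positivity), add_halves]
  rw [hhalf] at hsplit
  exact (ENNReal.add_le_add_iff_right ENNReal.ofReal_ne_top).1 hsplit

theorem volume_ge_of_tiltBary_mem {n : ℕ} (hn : 1 ≤ n) {ν : Measure (EucSp n)}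
    [IsProbabilityMeasure ν] (hlc : IsLogConcave ν)
    (hν : ν (Metric.closedBall 0 (16 * √n))ᶜ = 0) (hν0 : ∫ x, x ∂ν = 0)
    (hcov : ∀ θ : EucSp n, ‖θ‖ ^ 2 / 2 ≤ ∫ x, ⟪x, θ⟫ ^ 2 ∂ν) {σ : ℝ} (hσ0 : 0 < σ)
    (hσ : ∀ ρ : Measure (EucSp n), IsProbabilityMeasure ρ → IsIsotropic ρ →
      IsLogConcave ρ → ‖∫ x, (‖x‖ ^ 2) • x ∂ρ‖ ≤ √n * σ)
    {B : Set (EucSp n)} (hB : ∀ ξ, tiltBary ν ξ ∈ B) :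
    ENNReal.ofReal ((1 / (64 * Real.exp 1) / σ) ^ n) ≤ volume B := by
  have hK := isCompact_closedBall (0 : EucSp n) (16 * √n)
  have hac : ν ≪ volume := by
    obtain ⟨f, -, rfl⟩ := hlc
    exact withDensity_absolutelyContinuous _ _
  have hb0 : tiltBary ν 0 = 0 := by rw [tiltBary, expTilt_zero, hν0]
  have hn0 : (0 : ℝ) < n := by exact_mod_cast hn
  set s : ℝ := 1 / (32 * σ) with hs
  have hs0 : 0 < s := by positivity
  set a : ℝ := n / σ ^ 2 with ha
  have ha0 : 0 < a := by positivity
  have hcube := half_cube_le hs0.le hν hb0 ha0 (by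
    rw [mul_pow, Real.sq_sqrt hn0.le, ha, hs]; field_simp; norm_num)
  set D := cube n s ∩ {ξ | ⟪tiltBary ν ξ, ξ⟫ ≤ a} with hD
  have hbc : Continuous (tiltBary ν) := continuous_iff_continuousAt.2 fun ξ =>
    (hasFDerivAt_tiltBary hK hν ξ).continuousAt
  have hDm : MeasurableSet D := (measurableSet_cube n s).inter
    (measurableSet_le (Continuous.measurable (by fun_prop)) measurable_const)
  have hdet0 : (1 / 2 : ℝ) ^ n ≤ (tiltCov ν 0).det := by
    refine pow_le_det (tiltCov_posDef hK hν hac 0).isHermitian (by norm_num) fun v => ?_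
    rw [dotProduct_tiltCov_mulVec hK hν, hb0, expTilt_zero]
    simp only [sub_zero, ← sq]
    linarith [hcov v]
  have hdet : ∀ ξ ∈ D, (1 / (2 * Real.exp 1)) ^ n ≤ (tiltCov ν ξ).det := by
    intro ξ hξ
    have h1 := log_det_tiltCov_ge hlc hK hν hσ hb0 ξ
    have h2 : σ ^ 2 * ⟪tiltBary ν ξ, ξ⟫ ≤ n := by
      calc _ ≤ σ ^ 2 * a := by gcongr; exact hξ.2
        _ = n := by rw [ha]; field_simp
    have h3 := Real.log_le_log (by positivity) hdet0
    rw [← Real.log_le_log_iff (by positivity) (tiltCov_posDef hK hν hac ξ).det_pos]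
    rw [Real.log_pow, Real.log_div one_ne_zero (by positivity),
      Real.log_mul two_ne_zero (Real.exp_pos _).ne', Real.log_exp, Real.log_one]
    rw [Real.log_pow, Real.log_div one_ne_zero two_ne_zero, Real.log_one] at h3
    nlinarith
  have himg := lintegral_abs_det_fderiv_eq_addHaar_image volume hDm
    (fun ξ _ => (hasFDerivAt_tiltBary hK hν ξ).hasFDerivWithinAt)
    (tiltBary_injective hK hν hac).injOn
  calc ENNReal.ofReal ((1 / (64 * Real.exp 1) / σ) ^ n)
      ≤ ENNReal.ofReal ((1 / (2 * Real.exp 1)) ^ n) * ENNReal.ofReal ((2 * s) ^ n / 2) := by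
        rw [← ENNReal.ofReal_mul (by positivity)]
        refine ENNReal.ofReal_le_ofReal ?_
        have h1 : (1 / 2 : ℝ) ^ n ≤ 1 / 2 := by
          simpa using pow_le_pow_of_le_one (by norm_num : (0 : ℝ) ≤ 1 / 2) (by norm_num) hn
        have h2 : 1 / (64 * Real.exp 1) / σ = (1 / (2 * Real.exp 1)) * (2 * s) * (1 / 2) := by
          rw [hs]; field_simp; norm_num
        rw [h2, mul_pow, mul_pow]
        have : 0 ≤ (1 / (2 * Real.exp 1)) ^ n * (2 * s) ^ n := by positivity
        nlinarith [mul_le_mul_of_nonneg_left h1 this]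
    _ ≤ ENNReal.ofReal ((1 / (2 * Real.exp 1)) ^ n) * volume D := by gcongr
    _ = ∫⁻ _ξ in D, ENNReal.ofReal ((1 / (2 * Real.exp 1)) ^ n) := by
        rw [setLIntegral_const]
    _ ≤ ∫⁻ ξ in D, ENNReal.ofReal |(LinearMap.toContinuousLinearMap
      (Matrix.toLin (EuclideanSpace.basisFun (Fin n) ℝ).toBasis
        (EuclideanSpace.basisFun (Fin n) ℝ).toBasis (tiltCov ν ξ))).det| := by
        refine setLIntegral_mono' hDm fun ξ hξ => ENNReal.ofReal_le_ofReal ?_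
        have e : (LinearMap.toContinuousLinearMap
          (Matrix.toLin (EuclideanSpace.basisFun (Fin n) ℝ).toBasis
          (EuclideanSpace.basisFun (Fin n) ℝ).toBasis (tiltCov ν ξ))).det = (tiltCov ν ξ).det := by
          rw [← LinearMap.det_toLin (EuclideanSpace.basisFun (Fin n) ℝ).toBasis]
          rfl
        rw [e]
        exact (hdet ξ hξ).trans (le_abs_self _)
    _ = volume (tiltBary ν '' D) := himg
    _ ≤ volume B := measure_mono (by rintro _ ⟨ξ, -, rfl⟩; exact hB ξ)

theorem norm_integral_le_sqrt_mul_sigmaBar {n : ℕ} (hn : 1 ≤ n) (hσ : 0 < sigmaBar n)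
    (ρ : Measure (EucSp n)) (hρ : IsProbabilityMeasure ρ) (hi : IsIsotropic ρ)
    (hl : IsLogConcave ρ) : ‖∫ x, (‖x‖ ^ 2) • x ∂ρ‖ ≤ √n * sigmaBar n := by
  have hn0 : (0 : ℝ) < √n := Real.sqrt_pos.2 (by exact_mod_cast hn)
  rw [sigmaBar, mul_inv_cancel_left₀ hn0.ne']
  refine le_csSup ?_ ⟨ρ, hρ, hi, hl, rfl⟩
  by_contra hb
  rw [sigmaBar, Real.sSup_of_not_bddAbove hb, mul_zero] at hσ
  exact lt_irrefl _ hσ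

theorem sigmaBar_nonneg (n : ℕ) : 0 ≤ sigmaBar n :=
  mul_nonneg (by positivity) (Real.sSup_nonneg (by rintro _ ⟨ρ, -, -, -, rfl⟩; exact norm_nonneg _))

theorem msupport_subset_of_isClosed {n : ℕ} {μ : Measure (EucSp n)} {K : Set (EucSp n)}
    (hK : IsClosed K) (hμ : μ Kᶜ = 0) : msupport μ ⊆ K := by
  intro x hx
  by_contra h
  exact hx Kᶜ (hK.isOpen_compl.mem_nhds h) hμ

theorem withDensity_ofReal_compl_pos {n : ℕ} {f : EucSp n → ℝ} (hf : Measurable f) :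
    (volume.withDensity fun x => ENNReal.ofReal (f x)) {x | 0 < f x}ᶜ = 0 := by
  rw [withDensity_apply_eq_zero hf.ennreal_ofReal]
  convert measure_empty (μ := (volume : Measure (EucSp n))) using 2
  ext x
  simp

theorem pos_subset_interior_msupport {n : ℕ} {f : EucSp n → ℝ} (hf : Measurable f)
    (ho : IsOpen {x | 0 < f x}) :
    {x | 0 < f x} ⊆ interior (msupport (volume.withDensity fun x => ENNReal.ofReal (f x))) := by
  refine interior_maximal (fun x hx U hU h0 => ?_) ho
  rw [withDensity_apply_eq_zero hf.ennreal_ofReal] at h0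
  have h1 : {x | 0 < f x} ∩ U ∈ nhds x := inter_mem (ho.mem_nhds hx) hU
  refine (Measure.measure_pos_of_mem_nhds volume h1).ne' ?_
  convert h0 using 3
  ext y
  simp

theorem tiltBary_mem_closure {n : ℕ} {ν : Measure (EucSp n)} [IsProbabilityMeasure ν]
    {K S : Set (EucSp n)} (hK : IsCompact K) (hν : ν Kᶜ = 0) (hS : Convex ℝ S) (hνS : ν Sᶜ = 0)
    (ξ : EucSp n) : tiltBary ν ξ ∈ closure S := by
  have := isProbabilityMeasure_expTilt hK hν ξ
  refine hS.closure.integral_mem isClosed_closure ?_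
    (integrable_of_compact_support hK (expTilt_absolutelyContinuous ν ξ hν) continuous_id')
  have h : ∀ᵐ x ∂(expTilt ν ξ), x ∈ S := by
    rw [ae_iff]
    exact expTilt_absolutelyContinuous ν ξ hνS
  exact h.mono fun x hx => subset_closure hx

theorem volume_closure_of_convex {n : ℕ} {S : Set (EucSp n)} (hS : Convex ℝ S) :
    volume (closure S) = volume S := by
  refine le_antisymm ?_ (measure_mono subset_closure)
  rw [closure_eq_self_union_frontier]
  refine (measure_union_le _ _).trans ?_
  rw [hS.addHaar_frontier volume, add_zero]

theorem setIntegral_le_integral_cond {n : ℕ} {μ : Measure (EucSp n)} [IsProbabilityMeasure μ]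
    {A : Set (EucSp n)} (hA0 : μ A ≠ 0) {g : EucSp n → ℝ} (hg : ∀ x, 0 ≤ g x) :
    ∫ x in A, g x ∂μ ≤ ∫ x, g x ∂(ProbabilityTheory.cond μ A) := by
  rw [ProbabilityTheory.cond, integral_smul_measure, smul_eq_mul]
  have h1 : 1 ≤ ((μ A)⁻¹).toReal := by
    rw [← ENNReal.toReal_one]
    exact ENNReal.toReal_mono (by simpa using hA0) (ENNReal.one_le_inv.2 prob_le_one)
  exact le_mul_of_one_le_left (integral_nonneg hg) h1

theorem measure_closedBall_ne_zero {n : ℕ} (hn : 1 ≤ n) {μ : Measure (EucSp n)}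
    [IsProbabilityMeasure μ] (hμ : IsLogConcave μ) (he : IsEvenMeasure μ) (hi : IsIsotropic μ)
    {K : Set (EucSp n)} (hK : IsCompact K) (hμK : μ Kᶜ = 0) :
    μ (Metric.closedBall 0 (16 * √n)) ≠ 0 := by
  intro h0
  have h := half_norm_sq_le_setIntegral_inner_sq hn hμ he hi hK hμK
    (EuclideanSpace.single ⟨0, hn⟩ 1)
  rw [Measure.restrict_eq_zero.2 h0, integral_zero_measure] at h
  norm_num at h

/-- There is a universal constant c > 0 such that for any compactly-supported, even,
isotropic, log-concave probability measure μ on ℝⁿ, with K the interior of the support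
of μ, Vol_n(K)^{1/n} ≥ c / σ̲_n. -/
theorem volume_support_lower_bound :
    ∃ c : ℝ, 0 < c ∧ ∀ n : ℕ, 1 ≤ n → ∀ μ : Measure (EucSp n),
      IsProbabilityMeasure μ → IsCompactlySupported μ → IsEvenMeasure μ →
      IsIsotropic μ → IsLogConcave μ →
        c / sigmaBar n ≤ (volume (interior (msupport μ))).toReal ^ ((n : ℝ)⁻¹) := by
  refine ⟨1 / (64 * Real.exp 1), by positivity, ?_⟩
  rintro n hn μ hp ⟨K, hK, hμK⟩ he hi hl
  rcases (sigmaBar_nonneg n).eq_or_lt with h0 | hσ0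
  · rw [← h0, div_zero]
    positivity
  have hA0 := measure_closedBall_ne_zero hn hl he hi hK hμK
  set A : Set (EucSp n) := Metric.closedBall 0 (16 * √n) with hA
  have hAm : MeasurableSet A := Metric.isClosed_closedBall.measurableSet
  have hAc : IsCompact A := isCompact_closedBall _ _
  have hνp := ProbabilityTheory.cond_isProbabilityMeasure hA0
  have hνA : ProbabilityTheory.cond μ A Aᶜ = 0 := by
    rw [ProbabilityTheory.cond_apply hAm]
    simp
  have hAe : -A = A := by
    ext x
    simp [hA]
  obtain ⟨f, hf, hfm, ho, hfμ⟩ := hl.exists_measurable_density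
  have hνS : ProbabilityTheory.cond μ A {x | 0 < f x}ᶜ = 0 := by
    refine ProbabilityTheory.cond_absolutelyContinuous ?_
    rw [hfμ]
    exact withDensity_ofReal_compl_pos hfm
  have hvol := volume_ge_of_tiltBary_mem hn (hl.cond (convex_closedBall _ _) hAm hA0) hνA
    (he.cond hAm hAe).integral_id_eq_zero
    (fun θ => (half_norm_sq_le_setIntegral_inner_sq hn hl he hi hK hμK θ).trans
      (setIntegral_le_integral_cond hA0 fun x => sq_nonneg _))
    hσ0 (norm_integral_le_sqrt_mul_sigmaBar hn hσ0)
    (tiltBary_mem_closure hAc hνA hf.convex_pos hνS)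
  rw [volume_closure_of_convex hf.convex_pos] at hvol
  have hsub := pos_subset_interior_msupport hfm ho
  rw [← hfμ] at hsub
  have hfin : volume (interior (msupport μ)) ≠ ⊤ :=
    ((measure_mono (interior_subset.trans (msupport_subset_of_isClosed hK.isClosed hμK))).trans_lt
      hK.measure_lt_top).ne
  have h := (ENNReal.ofReal_le_iff_le_toReal hfin).1 (hvol.trans (measure_mono hsub))
  have hr : 0 ≤ 1 / (64 * Real.exp 1) / sigmaBar n := by positivity
  rw [← Real.pow_rpow_inv_natCast hr (by omega : n ≠ 0)]
  exact Real.rpow_le_rpow (by positivity) h (by positivity)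
end
end

section
/- Suppose X is an isotropic random vector in ℝⁿ with finite third moments. Then |E X|X|²|² ≤ C n³ ∫_{S^{n−1}} ( E (X·θ)³ )² dσ_{n−1}(θ), where σ_{n−1} is the uniform Lebesgue probability measure on the unit sphere S^{n−1} and C > 0 is a universal constant. In fact one may take the explicit bound |E X|X|²|² ≤ ( n(2n+4)²/36 ) ∫_{S^{n−1}} ( E (X·θ)³ )² dσ_{n−1}(θ). -/
open MeasureTheory Real Set Filter Topology RealInnerProductSpace
noncomputable section

/-- The uniform (normalized) Lebesgue probability measure on the unit sphere S^{n-1}. -/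
def sphereUniform (n : ℕ) : Measure (Metric.sphere (0 : EucSp n) 1) :=
  ((volume : Measure (EucSp n)).toSphere Set.univ)⁻¹ • (volume : Measure (EucSp n)).toSphere

/-- A linear isometry equivalence, restricted to the unit sphere. -/
def sphereMap {E : Type*} [NormedAddCommGroup E] [NormedSpace ℝ E] (R : E ≃ₗᵢ[ℝ] E)
    (θ : Metric.sphere (0 : E) 1) : Metric.sphere (0 : E) 1 :=
  ⟨R θ, by simp⟩

open scoped Pointwise in
lemma measurePreserving_sphereMap {E : Type*} [NormedAddCommGroup E] [InnerProductSpace ℝ E]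
    [FiniteDimensional ℝ E] [MeasurableSpace E] [BorelSpace E] (R : E ≃ₗᵢ[ℝ] E) :
    MeasurePreserving (sphereMap R) (volume : Measure E).toSphere
      (volume : Measure E).toSphere := by
  have hm : Measurable (sphereMap R) :=
    ((R.continuous.comp continuous_subtype_val).subtype_mk _).measurable
  refine ⟨hm, Measure.ext fun s hs => ?_⟩
  rw [Measure.map_apply hm hs, Measure.toSphere_apply' _ hs, Measure.toSphere_apply' _ (hm hs)]
  have hset : Ioo (0 : ℝ) 1 • ((↑) '' (sphereMap R ⁻¹' s) : Set E) =
      R ⁻¹' (Ioo (0 : ℝ) 1 • ((↑) '' s : Set E)) := by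
    ext x
    simp only [Set.mem_smul, Set.mem_image, Set.mem_preimage]
    constructor
    · rintro ⟨r, hr, _, ⟨θ, hθ, rfl⟩, rfl⟩
      exact ⟨r, hr, _, ⟨_, hθ, rfl⟩, by simp [sphereMap]⟩
    · rintro ⟨r, hr, _, ⟨θ, hθ, rfl⟩, h⟩
      refine ⟨r, hr, _, ⟨sphereMap R.symm θ, ?_, rfl⟩, ?_⟩
      · convert hθ using 1
        exact Subtype.ext (by simp [sphereMap])
      · apply R.injective
        simp [sphereMap, h]
  rw [hset, ← R.measurePreserving.measure_preimage_emb
    R.toHomeomorph.measurableEmbedding (Ioo (0 : ℝ) 1 • ((↑) '' s : Set E))]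

instance sphereUniform.instIsProbabilityMeasure (n : ℕ) [NeZero n] :
    IsProbabilityMeasure (sphereUniform n) := by
  refine ⟨?_⟩
  rw [sphereUniform, Measure.smul_apply, smul_eq_mul]
  refine ENNReal.inv_mul_cancel ?_ (measure_ne_top _ _)
  rw [Measure.measure_univ_ne_zero]
  exact Measure.toSphere_ne_zero _

lemma measurePreserving_sphereMap_sphereUniform {n : ℕ} (R : EucSp n ≃ₗᵢ[ℝ] EucSp n) :
    MeasurePreserving (sphereMap R) (sphereUniform n) (sphereUniform n) :=
  (measurePreserving_sphereMap R).smul_measure _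

lemma integrable_sphereUniform {n : ℕ} [NeZero n] {f : Metric.sphere (0 : EucSp n) 1 → ℝ}
    (hf : Continuous f) : Integrable f (sphereUniform n) :=
  hf.integrable_of_hasCompactSupport (HasCompactSupport.of_compactSpace f)

lemma integral_inner_pow_four_eq_of_norm_eq {n : ℕ} {u v : EucSp n} (h : ‖u‖ = ‖v‖) :
    ∫ θ, ⟪u, (θ : EucSp n)⟫ ^ 4 ∂(sphereUniform n) =
      ∫ θ, ⟪v, (θ : EucSp n)⟫ ^ 4 ∂(sphereUniform n) := by
  have hR := measurePreserving_sphereMap_sphereUniform (Submodule.reflection (ℝ ∙ (u - v))ᗮ)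
  have hc : Continuous fun θ : Metric.sphere (0 : EucSp n) 1 => ⟪v, (θ : EucSp n)⟫ ^ 4 := by
    fun_prop
  nth_rw 2 [← hR.map_eq]
  rw [integral_map hR.measurable.aemeasurable hc.aestronglyMeasurable]
  refine integral_congr_ae (.of_forall fun θ => ?_)
  simp only [sphereMap]
  rw [← LinearIsometryEquiv.inner_map_map (Submodule.reflection (ℝ ∙ (u - v))ᗮ) u θ,
    Submodule.reflection_sub h]

/-- The fourth moment of a coordinate under the uniform measure on the sphere. -/
def sphereFourthMoment (n : ℕ) [NeZero n] : ℝ :=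
  ∫ θ, ⟪EuclideanSpace.single (0 : Fin n) (1 : ℝ), (θ : EucSp n)⟫ ^ 4 ∂(sphereUniform n)

lemma integral_inner_pow_four {n : ℕ} [NeZero n] (u : EucSp n) :
    ∫ θ, ⟪u, (θ : EucSp n)⟫ ^ 4 ∂(sphereUniform n) = sphereFourthMoment n * ⟪u, u⟫ ^ 2 := by
  rw [integral_inner_pow_four_eq_of_norm_eq
    (v := ‖u‖ • EuclideanSpace.single (0 : Fin n) (1 : ℝ)) (by simp [norm_smul])]
  simp_rw [real_inner_smul_left, mul_pow]
  rw [integral_const_mul, real_inner_self_eq_norm_sq, sphereFourthMoment]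
  ring

lemma integral_inner_pow_three_mul {n : ℕ} [NeZero n] (u v : EucSp n) :
    ∫ θ, ⟪u, (θ : EucSp n)⟫ ^ 3 * ⟪v, (θ : EucSp n)⟫ ∂(sphereUniform n) =
      sphereFourthMoment n * (⟪u, u⟫ * ⟪u, v⟫) := by
  have hi (w : EucSp n) : Integrable (fun θ : Metric.sphere (0 : EucSp n) 1 =>
      ⟪w, (θ : EucSp n)⟫ ^ 4) (sphereUniform n) := integrable_sphereUniform (by fun_prop)
  have hpol (θ : Metric.sphere (0 : EucSp n) 1) :
      ⟪u, (θ : EucSp n)⟫ ^ 3 * ⟪v, (θ : EucSp n)⟫ =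
        (1 / 6) * (⟪u + v, (θ : EucSp n)⟫ ^ 4 - ⟪u - v, (θ : EucSp n)⟫ ^ 4) -
        (1 / 48) * (⟪u + (2 : ℝ) • v, (θ : EucSp n)⟫ ^ 4 -
          ⟪u - (2 : ℝ) • v, (θ : EucSp n)⟫ ^ 4) := by
    simp only [inner_add_left, inner_sub_left, real_inner_smul_left]
    ring
  simp_rw [hpol]
  rw [integral_sub (integrable_sphereUniform (by fun_prop))
      (integrable_sphereUniform (by fun_prop)),
    integral_const_mul, integral_const_mul, integral_sub (hi _) (hi _),
    integral_sub (hi _) (hi _)]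
  simp only [integral_inner_pow_four]
  simp only [inner_add_left, inner_sub_left, inner_add_right,
    inner_sub_right, real_inner_smul_left, real_inner_smul_right, real_inner_comm u v]
  ring

lemma integral_inner_sq_mul_inner_sq {n : ℕ} [NeZero n] (u v : EucSp n) :
    ∫ θ, ⟪u, (θ : EucSp n)⟫ ^ 2 * ⟪v, (θ : EucSp n)⟫ ^ 2 ∂(sphereUniform n) =
      sphereFourthMoment n / 3 * (⟪u, u⟫ * ⟪v, v⟫ + 2 * ⟪u, v⟫ ^ 2) := by
  have hi (w : EucSp n) : Integrable (fun θ : Metric.sphere (0 : EucSp n) 1 =>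
      ⟪w, (θ : EucSp n)⟫ ^ 4) (sphereUniform n) := integrable_sphereUniform (by fun_prop)
  have hpol (θ : Metric.sphere (0 : EucSp n) 1) :
      ⟪u, (θ : EucSp n)⟫ ^ 2 * ⟪v, (θ : EucSp n)⟫ ^ 2 =
        (1 / 12) * (⟪u + v, (θ : EucSp n)⟫ ^ 4 + ⟪u - v, (θ : EucSp n)⟫ ^ 4) -
        (1 / 6) * (⟪u, (θ : EucSp n)⟫ ^ 4 + ⟪v, (θ : EucSp n)⟫ ^ 4) := by
    simp only [inner_add_left, inner_sub_left]
    ring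
  simp_rw [hpol]
  rw [integral_sub (integrable_sphereUniform (by fun_prop))
      (integrable_sphereUniform (by fun_prop)),
    integral_const_mul, integral_const_mul, integral_add (hi _) (hi _),
    integral_add (hi _) (hi _)]
  simp only [integral_inner_pow_four]
  simp only [inner_add_left, inner_sub_left, inner_add_right,
    inner_sub_right, real_inner_comm u v]
  ring

lemma integral_inner_sq_eq_fourthMoment_mul {n : ℕ} [NeZero n] (u : EucSp n) :
    ∫ θ, ⟪u, (θ : EucSp n)⟫ ^ 2 ∂(sphereUniform n) =
      sphereFourthMoment n * (n + 2) / 3 * ⟪u, u⟫ := by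
  let b := EuclideanSpace.basisFun (Fin n) ℝ
  have hsum (θ : Metric.sphere (0 : EucSp n) 1) : ⟪u, (θ : EucSp n)⟫ ^ 2 =
      ∑ i, ⟪u, (θ : EucSp n)⟫ ^ 2 * ⟪b i, (θ : EucSp n)⟫ ^ 2 := by
    rw [← Finset.mul_sum, b.sum_sq_inner_right, norm_eq_of_mem_sphere]
    ring
  rw [integral_congr_ae (.of_forall hsum),
    integral_finsetSum _ fun i _ => integrable_sphereUniform (by fun_prop)]
  simp_rw [integral_inner_sq_mul_inner_sq]
  rw [← Finset.mul_sum, Finset.sum_add_distrib, ← Finset.mul_sum, ← Finset.mul_sum,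
    b.sum_sq_inner_left]
  simp only [real_inner_self_eq_norm_sq, OrthonormalBasis.norm_eq_one, one_pow, mul_one,
    Finset.sum_const, Finset.card_univ, Fintype.card_fin, nsmul_eq_mul]
  ring

lemma sphereFourthMoment_eq (n : ℕ) [NeZero n] :
    sphereFourthMoment n = 3 / (n * (n + 2)) := by
  let b := EuclideanSpace.basisFun (Fin n) ℝ
  have h : ∑ i, ∫ θ, ⟪b i, (θ : EucSp n)⟫ ^ 2 ∂(sphereUniform n) = 1 := by
    rw [← integral_finsetSum _ fun i _ => integrable_sphereUniform (by fun_prop)]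
    simp_rw [b.sum_sq_inner_right, norm_eq_of_mem_sphere]
    simp
  simp only [integral_inner_sq_eq_fourthMoment_mul, real_inner_self_eq_norm_sq,
    OrthonormalBasis.norm_eq_one, one_pow, mul_one, Finset.sum_const, Finset.card_univ,
    Fintype.card_fin, nsmul_eq_mul] at h
  have hn : (n : ℝ) ≠ 0 := NeZero.ne _
  field_simp
  linarith

lemma integral_inner_sq {n : ℕ} [NeZero n] (u : EucSp n) :
    ∫ θ, ⟪u, (θ : EucSp n)⟫ ^ 2 ∂(sphereUniform n) = ‖u‖ ^ 2 / n := by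
  rw [integral_inner_sq_eq_fourthMoment_mul, sphereFourthMoment_eq, real_inner_self_eq_norm_sq]
  have hn : (n : ℝ) ≠ 0 := NeZero.ne _
  field_simp

lemma abs_inner_le_norm_of_mem_sphere {n : ℕ} (x : EucSp n)
    (θ : Metric.sphere (0 : EucSp n) 1) : |⟪x, (θ : EucSp n)⟫| ≤ ‖x‖ := by
  simpa using abs_real_inner_le_norm x θ

lemma continuous_integral_inner_pow_three {n : ℕ} {μ : Measure (EucSp n)}
    (h3 : Integrable (fun x => ‖x‖ ^ 3) μ) :
    Continuous fun θ : Metric.sphere (0 : EucSp n) 1 => ∫ x, ⟪x, (θ : EucSp n)⟫ ^ 3 ∂μ := by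
  refine continuous_of_dominated (bound := fun x => ‖x‖ ^ 3) (fun θ => ?_)
    (fun θ => .of_forall fun x => ?_) h3 (.of_forall fun x => by fun_prop)
  · exact Continuous.aestronglyMeasurable (by fun_prop)
  · rw [norm_pow, Real.norm_eq_abs]
    gcongr
    exact abs_inner_le_norm_of_mem_sphere x θ

/-- The third moment vector, tested against `v`, is a spherical average of the directional third
moments. -/
lemma integral_third_moment_mul_inner {n : ℕ} [NeZero n] {μ : Measure (EucSp n)}
    [IsProbabilityMeasure μ] (h3 : Integrable (fun x => ‖x‖ ^ 3) μ) (v : EucSp n) :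
    ∫ θ, (∫ x, ⟪x, (θ : EucSp n)⟫ ^ 3 ∂μ) * ⟪v, (θ : EucSp n)⟫ ∂(sphereUniform n) =
      sphereFourthMoment n * ⟪∫ x, (‖x‖ ^ 2) • x ∂μ, v⟫ := by
  have hint : Integrable (Function.uncurry fun (θ : Metric.sphere (0 : EucSp n) 1) (x : EucSp n) =>
      ⟪x, (θ : EucSp n)⟫ ^ 3 * ⟪v, (θ : EucSp n)⟫) ((sphereUniform n).prod μ) := by
    refine Integrable.mono' ((h3.comp_snd (sphereUniform n)).mul_const ‖v‖)
      (Continuous.aestronglyMeasurable (by fun_prop)) (.of_forall fun p => ?_)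
    rw [Function.uncurry_def, norm_mul, norm_pow, Real.norm_eq_abs, Real.norm_eq_abs]
    gcongr
    · exact abs_inner_le_norm_of_mem_sphere p.2 p.1
    · exact abs_inner_le_norm_of_mem_sphere v p.1
  have hv : Integrable (fun x : EucSp n => (‖x‖ ^ 2) • x) μ := by
    refine h3.mono' (Continuous.aestronglyMeasurable (by fun_prop)) (.of_forall fun x => ?_)
    rw [norm_smul, norm_pow, norm_norm]
    exact le_of_eq (by ring)
  simp_rw [← integral_mul_const]
  rw [integral_integral_swap hint]
  simp_rw [integral_inner_pow_three_mul]
  rw [integral_const_mul, real_inner_comm, ← integral_inner hv]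
  congr 1
  refine integral_congr_ae (.of_forall fun x => ?_)
  simp only [real_inner_smul_right, real_inner_self_eq_norm_sq, real_inner_comm]

lemma norm_sq_third_moment_le {n : ℕ} [NeZero n] {μ : Measure (EucSp n)}
    [IsProbabilityMeasure μ] (h3 : Integrable (fun x => ‖x‖ ^ 3) μ) :
    ‖∫ x, (‖x‖ ^ 2) • x ∂μ‖ ^ 2 ≤ ((n : ℝ) * (2 * (n : ℝ) + 4) ^ 2 / 36) *
      ∫ θ : Metric.sphere (0 : EucSp n) 1,
        (∫ x, ⟪x, (θ : EucSp n)⟫ ^ 3 ∂μ) ^ 2 ∂(sphereUniform n) := by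
  have hF := continuous_integral_inner_pow_three h3
  set F := fun θ : Metric.sphere (0 : EucSp n) 1 => ∫ x, ⟪x, (θ : EucSp n)⟫ ^ 3 ∂μ with hFdef
  set v := ∫ x, (‖x‖ ^ 2) • x ∂μ with hv
  have hFv : ∫ θ, F θ * ⟪v, (θ : EucSp n)⟫ ∂(sphereUniform n) =
      sphereFourthMoment n * ‖v‖ ^ 2 := by
    rw [← real_inner_self_eq_norm_sq]
    exact integral_third_moment_mul_inner h3 v
  set t : ℝ := n * sphereFourthMoment n with ht
  have hnonneg : 0 ≤ ∫ θ, (F θ - t * ⟪v, (θ : EucSp n)⟫) ^ 2 ∂(sphereUniform n) :=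
    integral_nonneg fun θ => sq_nonneg _
  have hexp (θ : Metric.sphere (0 : EucSp n) 1) : (F θ - t * ⟪v, (θ : EucSp n)⟫) ^ 2 =
      F θ ^ 2 - 2 * t * (F θ * ⟪v, (θ : EucSp n)⟫) + t ^ 2 * ⟪v, (θ : EucSp n)⟫ ^ 2 := by
    ring
  simp_rw [hexp] at hnonneg
  rw [integral_add (integrable_sphereUniform (by fun_prop))
      (integrable_sphereUniform (by fun_prop)),
    integral_sub (integrable_sphereUniform (by fun_prop))
      (integrable_sphereUniform (by fun_prop)),
    integral_const_mul, integral_const_mul, hFv, integral_inner_sq, ht,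
    sphereFourthMoment_eq] at hnonneg
  change ‖v‖ ^ 2 ≤ _ * ∫ θ, F θ ^ 2 ∂(sphereUniform n)
  set I := ∫ θ, F θ ^ 2 ∂(sphereUniform n)
  have hn : (0 : ℝ) < n := Nat.cast_pos.2 (NeZero.pos n)
  have hI : 9 / (n * (n + 2) ^ 2) * ‖v‖ ^ 2 ≤ I := by
    have : I - 2 * (n * (3 / (n * (n + 2)))) * (3 / (n * (n + 2)) * ‖v‖ ^ 2) +
        (n * (3 / (n * (n + 2)))) ^ 2 * (‖v‖ ^ 2 / n) =
        I - 9 / (n * (n + 2) ^ 2) * ‖v‖ ^ 2 := by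
      field_simp
      ring
    linarith
  calc ‖v‖ ^ 2 = (n * (2 * n + 4) ^ 2 / 36) * (9 / (n * (n + 2) ^ 2) * ‖v‖ ^ 2) := by
        field_simp
        ring
    _ ≤ _ := by gcongr

/-- For an isotropic random vector X in ℝⁿ with finite third moments,
|E X|X|²|² ≤ C n³ ∫_{S^{n−1}} (E (X·θ)³)² dσ_{n−1}(θ) for a universal constant C > 0;
in fact |E X|X|²|² ≤ (n(2n+4)²/36) ∫_{S^{n−1}} (E (X·θ)³)² dσ_{n−1}(θ). -/
theorem norm_sq_third_moment_le_sphere_integral :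
    (∃ C : ℝ, 0 < C ∧ ∀ n : ℕ, 1 ≤ n → ∀ μ : Measure (EucSp n),
      IsProbabilityMeasure μ → IsIsotropic μ → Integrable (fun x => ‖x‖ ^ 3) μ →
        ‖∫ x, (‖x‖ ^ 2) • x ∂μ‖ ^ 2 ≤ C * (n : ℝ) ^ 3 *
          ∫ θ : Metric.sphere (0 : EucSp n) 1,
            (∫ x, ⟪x, (θ : EucSp n)⟫ ^ 3 ∂μ) ^ 2 ∂(sphereUniform n)) ∧
    (∀ n : ℕ, 1 ≤ n → ∀ μ : Measure (EucSp n),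
      IsProbabilityMeasure μ → IsIsotropic μ → Integrable (fun x => ‖x‖ ^ 3) μ →
        ‖∫ x, (‖x‖ ^ 2) • x ∂μ‖ ^ 2 ≤
          ((n : ℝ) * (2 * (n : ℝ) + 4) ^ 2 / 36) *
          ∫ θ : Metric.sphere (0 : EucSp n) 1,
            (∫ x, ⟪x, (θ : EucSp n)⟫ ^ 3 ∂μ) ^ 2 ∂(sphereUniform n)) := by
  refine ⟨⟨1, one_pos, fun n hn μ _ _ h3 => ?_⟩, fun n hn μ _ _ h3 => ?_⟩
  · have : NeZero n := ⟨by lia⟩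
    refine (norm_sq_third_moment_le h3).trans
      (mul_le_mul_of_nonneg_right ?_ (integral_nonneg fun θ => sq_nonneg _))
    have hn' : (1 : ℝ) ≤ n := by exact_mod_cast hn
    calc (n : ℝ) * (2 * n + 4) ^ 2 / 36 ≤ n * (2 * n + 4 * n) ^ 2 / 36 := by
          gcongr
          linarith
      _ = 1 * (n : ℝ) ^ 3 := by ring
  · have : NeZero n := ⟨by lia⟩
    exact norm_sq_third_moment_le h3
end
end
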